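/- For every real λ with 2 ≤ λ < λ* there exists N ∈ ℕ such that every connected graph G satisfying −λ ≤ λ₁(G) < −2 has at most N vertices; equivalently, up to isomorphism there are only finitely many connected graphs whose smallest eigenvalue lies in the interval [−λ, −2). -/

import Mathlib

open Classical

/-- An eigenvalue of a real matrix indexed by a finite type. -/
def IsEigenvalue {V : Type*} [Fintype V] (A : Matrix V V ℝ) (μ : ℝ) : Prop :=
  ∃ v : V → ℝ, v ≠ 0 ∧ A.mulVec v = μ • v

/-- The adjacency matrix (over ℝ) of a simple graph. -/
noncomputable def adjMat {V : Type*} [Fintype V] (G : SimpleGraph V) : Matrix V V ℝ :=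
  fun i j => if G.Adj i j then 1 else 0

/-- The smallest eigenvalue of a real matrix. -/
noncomputable def minEig {V : Type*} [Fintype V] (A : Matrix V V ℝ) : ℝ :=
  sInf {μ : ℝ | IsEigenvalue A μ}

/-- The scalars `ε = λ - 2`, `c = 1 / ε` and the stiffness `κ` of an infinite path, for `λ = t + 1 / t`
below the critical value. -/
structure Params (t ε c κ : ℝ) : Prop where
  one_lt : 1 < t
  below : t ^ 6 < t ^ 2 + 1
  eps : ε = t + t⁻¹ - 2
  c_eq : c = t / (t - 1) ^ 2
  k_eq : κ = t / (t - 1)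

namespace Params

variable {t ε c κ : ℝ}

lemma t_lt (h : Params t ε c κ) : t < 1.152 := by
  have h1 := h.below
  have h2 := h.one_lt
  by_contra! hc
  have h3 : (1.152 : ℝ) ^ 2 ≤ t ^ 2 := by gcongr
  nlinarith [sq_nonneg (t ^ 2 - 1.327104), mul_nonneg (sub_nonneg.2 h3) (sq_nonneg (t ^ 2))]

lemma c_pos (h : Params t ε c κ) : 0 < c := by
  have h2 := h.one_lt
  rw [h.c_eq]
  have : 0 < t - 1 := by linarith
  positivity

lemma k_pos (h : Params t ε c κ) : 0 < κ := by
  have h2 := h.one_lt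
  rw [h.k_eq]
  have : 0 < t - 1 := by linarith
  positivity

lemma c_mul_eps (h : Params t ε c κ) : c * ε = 1 := by
  have h2 := h.one_lt
  have : t - 1 ≠ 0 := by linarith
  rw [h.c_eq, h.eps]
  field_simp
  ring

lemma eps_pos (h : Params t ε c κ) : 0 < ε := by
  have h1 := h.c_mul_eps
  have h2 := h.c_pos
  by_contra! hc
  nlinarith

lemma sq_lower (h : Params t ε c κ) (y z : ℝ) : 2 * y * z - ε * y ^ 2 ≤ c * z ^ 2 := by
  have h1 := h.c_mul_eps
  have h2 : 0 ≤ c * (z - ε * y) ^ 2 := mul_nonneg h.c_pos.le (sq_nonneg _)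
  have h3 : c * (z - ε * y) ^ 2 = c * z ^ 2 - 2 * y * z * (c * ε) + ε * y ^ 2 * (c * ε) := by ring
  rw [h3, h1] at h2
  linarith

lemma path_step (h : Params t ε c κ) (a b : ℝ) :
    κ * (a ^ 2 - b ^ 2) ≤ a ^ 2 + c * (a - b) ^ 2 := by
  have h2 := h.one_lt
  have h3 : 0 < t - 1 := by linarith
  have h4 : a ^ 2 + c * (a - b) ^ 2 - κ * (a ^ 2 - b ^ 2) = (a - t * b) ^ 2 / (t - 1) ^ 2 := by
    rw [h.c_eq, h.k_eq]
    field_simp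
    ring
  have h5 : 0 ≤ (a - t * b) ^ 2 / (t - 1) ^ 2 := by positivity
  linarith

lemma three_bound (h : Params t ε c κ) (m₀ m₁ m₂ m₃ : ℝ) :
    t⁻¹ + t⁻¹ ^ 3 + t⁻¹ ^ 5 ≤ (1 - m₀) ^ 2 + (1 - m₁) ^ 2 + (1 - m₂) ^ 2
      + c * ((m₀ - m₁) ^ 2 + (m₁ - m₂) ^ 2 + (m₂ - m₃) ^ 2) + κ * m₃ ^ 2 := by
  have h2 := h.one_lt
  have h3 : 0 < t - 1 := by linarith
  have hs : κ * m₂ ^ 2 ≤ m₂ ^ 2 + c * (m₂ - m₃) ^ 2 + κ * m₃ ^ 2 := by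
    linarith [h.path_step m₂ m₃]
  obtain ⟨x, hx⟩ : ∃ x, x = t⁻¹ := ⟨_, rfl⟩
  rw [← hx]
  have e1 := h.sq_lower (x ^ 3) (m₀ - m₁)
  have e2 := h.sq_lower (x ^ 2 + x ^ 4) (m₁ - m₂)
  have e3 := sq_nonneg (1 - m₀ - x ^ 3)
  have e4 := sq_nonneg (1 - m₁ - (x ^ 2 + x ^ 4 - x ^ 3))
  have e5 := sq_nonneg (1 - m₂ - (x + x ^ 3 + x ^ 5 - (x ^ 2 + x ^ 4)))
  have e6 : 2 * (x + x ^ 3 + x ^ 5) * m₂ - (x + x ^ 3 + x ^ 5) ^ 2 * (t - 1)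
      ≤ (κ - 1) * m₂ ^ 2 := by
    have : (κ - 1) * m₂ ^ 2 - (2 * (x + x ^ 3 + x ^ 5) * m₂ - (x + x ^ 3 + x ^ 5) ^ 2 * (t - 1))
        = (m₂ - (t - 1) * (x + x ^ 3 + x ^ 5)) ^ 2 / (t - 1) := by
      rw [h.k_eq]
      field_simp
      ring
    have h5 : 0 ≤ (m₂ - (t - 1) * (x + x ^ 3 + x ^ 5)) ^ 2 / (t - 1) := by positivity
    linarith
  have e7 : (x ^ 3) ^ 2 + (x ^ 2 + x ^ 4 - x ^ 3) ^ 2 + (x + x ^ 3 + x ^ 5 - (x ^ 2 + x ^ 4)) ^ 2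
      + ε * (x ^ 3) ^ 2 + ε * (x ^ 2 + x ^ 4) ^ 2 + (x + x ^ 3 + x ^ 5) ^ 2 * (t - 1)
      = x + x ^ 3 + x ^ 5 := by
    rw [h.eps, hx]
    field_simp
    ring
  nlinarith

lemma lt_three_bound (h : Params t ε c κ) : t + t⁻¹ < t⁻¹ + t⁻¹ ^ 3 + t⁻¹ ^ 5 := by
  have h1 := h.below
  have h2 := h.one_lt
  have h0 : 0 < t := by linarith
  have : t⁻¹ + t⁻¹ ^ 3 + t⁻¹ ^ 5 - (t + t⁻¹) = (t ^ 2 + 1 - t ^ 6) / t ^ 5 := by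
    field_simp
    ring
  have : 0 < (t ^ 2 + 1 - t ^ 6) / t ^ 5 := div_pos (by linarith) (by positivity)
  linarith

lemma fork_identity (h : Params t ε c κ) :
    (t / (t ^ 2 + 1)) ^ 2 + ε * (t / (t ^ 4 - 1)) ^ 2 + ε * (t ^ 3 / (t ^ 4 - 1)) ^ 2
      + (t ^ 3 / (t ^ 4 - 1) + t / (t ^ 4 - 1)) ^ 2 / κ = t ^ 3 / (t ^ 4 - 1) := by
  have h2 := h.one_lt
  have h3 : t - 1 ≠ 0 := by linarith
  have h4 : t + 1 ≠ 0 := by linarith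
  have h5 : t ^ 2 + 1 ≠ 0 := by positivity
  have h6 : t ^ 4 - 1 = (t - 1) * (t + 1) * (t ^ 2 + 1) := by ring
  rw [h.eps, h.k_eq, h6]
  field_simp
  ring

lemma fork_sub (h : Params t ε c κ) :
    t ^ 3 / (t ^ 4 - 1) - t / (t ^ 4 - 1) = t / (t ^ 2 + 1) := by
  have h2 := h.one_lt
  have h3 : t - 1 ≠ 0 := by linarith
  have h4 : t + 1 ≠ 0 := by linarith
  have h5 : t ^ 2 + 1 ≠ 0 := by positivity
  have h6 : t ^ 4 - 1 = (t - 1) * (t + 1) * (t ^ 2 + 1) := by ring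
  rw [h6]
  field_simp
  ring

lemma pow_four_sub_one_pos (h : Params t ε c κ) : 0 < t ^ 4 - 1 :=
  sub_pos.2 (one_lt_pow₀ h.one_lt (by norm_num))

lemma k_sq_lower (h : Params t ε c κ) (γ z : ℝ) : 2 * γ * z - γ ^ 2 / κ ≤ κ * z ^ 2 := by
  have hk := h.k_pos
  have h1 : κ * z ^ 2 - (2 * γ * z - γ ^ 2 / κ) = (κ * z - γ) ^ 2 / κ := by
    field_simp
    ring
  have : 0 ≤ (κ * z - γ) ^ 2 / κ := by positivity
  linarith

/-- The energy of the half-integral profile at a fork which ends a long path. -/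
lemma fork_bound (h : Params t ε c κ) {m₀ m₁ m₂ q : ℝ} (hq : 1 - m₀ - m₁ ≤ q) :
    t ^ 3 / (t ^ 4 - 1) ≤ m₀ ^ 2 + m₁ ^ 2
      + c * ((m₀ - m₁) ^ 2 + (m₁ - m₂) ^ 2 + q ^ 2) + κ * m₂ ^ 2 := by
  have h1 := h.fork_identity
  have h2 := h.fork_sub
  have h3 : 0 ≤ t ^ 3 / (t ^ 4 - 1) :=
    div_nonneg (pow_nonneg (by linarith [h.one_lt]) 3) h.pow_four_sub_one_pos.le
  have h4 := mul_le_mul_of_nonneg_left hq h3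
  generalize t / (t ^ 2 + 1) = α at *
  generalize t ^ 3 / (t ^ 4 - 1) = y at *
  generalize t / (t ^ 4 - 1) = β at *
  subst h2
  linarith [h.sq_lower β (m₀ - m₁), h.sq_lower y q, sq_nonneg (m₀ - (y - β)),
    h.path_step m₁ m₂, h.k_sq_lower (y + β) m₁]

lemma fork_bound' (h : Params t ε c κ) {m₀ m₁ m₂ q : ℝ} (hq : 1 - m₀ - m₁ ≤ q) :
    t ^ 3 / (t ^ 4 - 1) ≤ (1 - m₀) ^ 2 + m₁ ^ 2
      + c * ((m₀ - m₁) ^ 2 + (m₁ - m₂) ^ 2 + q ^ 2) + κ * m₂ ^ 2 := by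
  have h1 := h.fork_identity
  have h2 := h.fork_sub
  have h3 : 0 ≤ t / (t ^ 4 - 1) :=
    div_nonneg (by linarith [h.one_lt]) h.pow_four_sub_one_pos.le
  have h4 := mul_le_mul_of_nonneg_left hq h3
  generalize t / (t ^ 2 + 1) = α at *
  generalize t ^ 3 / (t ^ 4 - 1) = y at *
  generalize t / (t ^ 4 - 1) = β at *
  subst h2
  linarith [h.sq_lower y (m₀ - m₁), h.sq_lower β q, sq_nonneg (1 - m₀ - (y - β)),
    h.path_step m₁ m₂, h.k_sq_lower (y + β) m₁]

lemma lt_fork_bound (h : Params t ε c κ) : t + t⁻¹ < t ^ 3 / (t ^ 4 - 1) := by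
  have h1 := h.below
  have h2 := h.one_lt
  have h0 : 0 < t := by linarith
  have h4 : 0 < t ^ 4 - 1 := by nlinarith [sq_nonneg (t ^ 2 - 1), sq_nonneg (t - 1)]
  have : t ^ 3 / (t ^ 4 - 1) - (t + t⁻¹) = (t ^ 2 + 1 - t ^ 6) / (t * (t ^ 4 - 1)) := by
    field_simp
    ring
  have : 0 < (t ^ 2 + 1 - t ^ 6) / (t * (t ^ 4 - 1)) := div_pos (by linarith) (by positivity)
  linarith

lemma eps_lt (h : Params t ε c κ) : ε < 0.021 := by
  have h1 := h.one_lt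
  have h2 := h.t_lt
  have h3 : ε * t = (t - 1) ^ 2 := by
    rw [h.eps]
    field_simp
    ring
  nlinarith

lemma k_gt (h : Params t ε c κ) : 7.5 < κ := by
  have h1 := h.one_lt
  have h2 := h.t_lt
  rw [h.k_eq, lt_div_iff₀ (by linarith)]
  linarith

lemma c_gt (h : Params t ε c κ) : 47 < c := by
  have h1 := h.c_mul_eps
  have h2 := h.eps_lt
  have h3 := h.eps_pos
  by_contra! hc
  nlinarith

lemma two_ones_bound (h : Params t ε c κ) {m₀ m₁ m₂ : ℝ} (h₁ : 1 / 2 ≤ m₁) :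
    2.1 ≤ (1 - m₀) ^ 2 + (1 - m₁) ^ 2
      + c * ((m₀ - m₁) ^ 2 + (m₁ - m₂) ^ 2) + κ * m₂ ^ 2 := by
  have h2 := h.path_step m₁ m₂
  have h3 := h.k_gt
  have h4 := h.c_gt
  have e1 : 47 * (m₀ - m₁) ^ 2 ≤ c * (m₀ - m₁) ^ 2 := by gcongr
  have e2 : 7.5 * m₁ ^ 2 ≤ κ * m₁ ^ 2 := by gcongr
  nlinarith [sq_nonneg (m₀ - m₁), sq_nonneg (m₁ - 1/2), sq_nonneg (1 - m₀ - 48 * (m₀ - m₁)), sq_nonneg (1-m₀ - 0.49), sq_nonneg (m₀ - m₁ - 0.01)]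

lemma height_two_bound (h : Params t ε c κ) (m₀ m₁ m₂ : ℝ) :
    2.1 ≤ (2 - m₀) ^ 2 + c * ((m₀ - m₁) ^ 2 + (m₁ - m₂) ^ 2) + κ * m₂ ^ 2 := by
  have h3 := h.k_gt
  have h4 := h.eps_lt
  have e2 : 7.5 * m₂ ^ 2 ≤ κ * m₂ ^ 2 := by gcongr
  nlinarith [h.sq_lower 1 (m₀ - m₁), h.sq_lower 1 (m₁ - m₂), sq_nonneg (2 - m₀ - 1), sq_nonneg (7.5 * m₂ - 1)]

end Params

/-- `K` is so large that the boundary effects of a path with `K` vertices are negligible. -/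
def IsLarge (t κ : ℝ) (K : ℕ) : Prop :=
  ∀ y : ℝ, K * y ≤ t + t⁻¹ → t + t⁻¹ + κ * y < t⁻¹ + t⁻¹ ^ 3 + t⁻¹ ^ 5 ∧
    t + t⁻¹ + κ * y < t ^ 3 / (t ^ 4 - 1) ∧ t + t⁻¹ + κ * y < 2.1

namespace Params

variable {t ε c κ : ℝ}

lemma exists_isLarge (h : Params t ε c κ) : ∃ K : ℕ, 5 ≤ K ∧ IsLarge t κ K := by
  have h1 := h.lt_three_bound
  have h2 := h.lt_fork_bound
  have h3 : t + t⁻¹ < 2.1 := by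
    have := h.eps_lt
    have := h.eps
    linarith
  have hk := h.k_pos
  obtain ⟨δ, hδ, hd1, hd2, hd3⟩ : ∃ δ > 0, t + t⁻¹ + δ ≤ t⁻¹ + t⁻¹ ^ 3 + t⁻¹ ^ 5 ∧
      t + t⁻¹ + δ ≤ t ^ 3 / (t ^ 4 - 1) ∧ t + t⁻¹ + δ ≤ 2.1 := by
    refine ⟨min (t⁻¹ + t⁻¹ ^ 3 + t⁻¹ ^ 5 - (t + t⁻¹))
      (min (t ^ 3 / (t ^ 4 - 1) - (t + t⁻¹)) (2.1 - (t + t⁻¹))), ?_, ?_, ?_, ?_⟩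
    · exact lt_min (by linarith) (lt_min (by linarith) (by linarith))
    · linarith [min_le_left (t⁻¹ + t⁻¹ ^ 3 + t⁻¹ ^ 5 - (t + t⁻¹))
        (min (t ^ 3 / (t ^ 4 - 1) - (t + t⁻¹)) (2.1 - (t + t⁻¹)))]
    · linarith [(min_le_right (t⁻¹ + t⁻¹ ^ 3 + t⁻¹ ^ 5 - (t + t⁻¹))
        (min (t ^ 3 / (t ^ 4 - 1) - (t + t⁻¹)) (2.1 - (t + t⁻¹)))).trans (min_le_left _ _)]
    · linarith [(min_le_right (t⁻¹ + t⁻¹ ^ 3 + t⁻¹ ^ 5 - (t + t⁻¹))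
        (min (t ^ 3 / (t ^ 4 - 1) - (t + t⁻¹)) (2.1 - (t + t⁻¹)))).trans (min_le_right _ _)]
  obtain ⟨K, hK⟩ := exists_nat_gt (κ * 2.1 / δ)
  rw [div_lt_iff₀ hδ] at hK
  refine ⟨K + 5, by omega, fun y hy => ?_⟩
  have hy' : κ * y < δ := by
    by_contra! hc
    push_cast at hy
    have hy0 : 0 < y := by
      by_contra! hy0
      nlinarith
    have : κ * ((K + 5) * y) ≤ κ * (t + t⁻¹) := by gcongr
    have : δ * (K + 5 : ℝ) ≤ κ * y * (K + 5) := by gcongr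
    nlinarith
  exact ⟨by linarith, by linarith, by linarith⟩

lemma path_sum (h : Params t ε c κ) (m : ℕ → ℝ) {j N : ℕ} (hj : j ≤ N) :
    κ * (m j ^ 2 - m N ^ 2) ≤
      ∑ k ∈ Finset.Ico j N, m k ^ 2 + c * ∑ k ∈ Finset.Ico j N, (m k - m (k + 1)) ^ 2 := by
  induction N, hj using Nat.le_induction with
  | base => simp
  | succ N hN ih =>
    rw [Finset.sum_Ico_succ_top hN, Finset.sum_Ico_succ_top hN]
    linarith [h.path_step (m N) (m (N + 1))]

end Params

lemma mul_last_sq_le {m : ℕ → ℝ} (hm : Antitone m) (h0 : ∀ k, 0 ≤ m k) {p N K : ℕ}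
    (hK : p + K ≤ N + 1) : K * m N ^ 2 ≤ ∑ k ∈ Finset.Ico p (N + 1), m k ^ 2 := by
  have h1 : ∑ k ∈ Finset.Ico p (N + 1), m N ^ 2 ≤ ∑ k ∈ Finset.Ico p (N + 1), m k ^ 2 := by
    refine Finset.sum_le_sum fun k hk => ?_
    rw [Finset.mem_Ico] at hk
    have := hm (show k ≤ N by omega)
    have := h0 N
    gcongr
  rw [Finset.sum_const, Nat.card_Ico, nsmul_eq_mul] at h1
  refine le_trans ?_ h1
  gcongr
  omega

namespace Params

variable {t ε c κ : ℝ}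

lemma sorted_three (h : Params t ε c κ) {K : ℕ} (hK5 : 5 ≤ K) (hK : IsLarge t κ K) {m : ℕ → ℝ}
    (hm : Antitone m) (h0 : ∀ k, 0 ≤ m k) {p n : ℕ} (hp : 3 ≤ p) (hn : p + K ≤ n)
    (hE : ∑ k ∈ Finset.range p, (1 - m k) ^ 2 + ∑ k ∈ Finset.Ico p n, m k ^ 2
      + c * ∑ k ∈ Finset.range (n - 1), (m k - m (k + 1)) ^ 2 ≤ t + t⁻¹) : False := by
  obtain ⟨r, rfl⟩ : ∃ r, p = r + 3 := ⟨p - 3, by omega⟩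
  obtain ⟨N, rfl⟩ : ∃ N, n = N + 1 := ⟨n - 1, by omega⟩
  have hc := h.c_pos
  have h1 := mul_last_sq_le hm h0 hn
  have h2 := h.path_sum m (show r + 3 ≤ N by omega)
  have h3 := h.three_bound (m r) (m (r + 1)) (m (r + 2)) (m (r + 3))
  rw [Nat.add_sub_cancel, Finset.range_eq_Ico, Finset.range_eq_Ico,
    ← Finset.sum_Ico_consecutive _ (Nat.zero_le r)
    (show r ≤ r + 3 by omega), ← Finset.sum_Ico_consecutive _ (Nat.zero_le r)
    (show r ≤ N by omega), ← Finset.sum_Ico_consecutive _ (show r ≤ r + 3 by omega)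
    (show r + 3 ≤ N by omega)] at hE
  have e1 : ∀ f : ℕ → ℝ, ∑ k ∈ Finset.Ico r (r + 3), f k = f r + f (r + 1) + f (r + 2) := by
    intro f
    rw [Finset.sum_Ico_eq_sum_range, show r + 3 - r = 3 by omega]
    simp [Finset.sum_range_succ]
  rw [e1, e1, Finset.sum_Ico_succ_top (show r + 3 ≤ N by omega)] at hE
  have e2 : 0 ≤ ∑ k ∈ Finset.Ico 0 r, (1 - m k) ^ 2 := Finset.sum_nonneg fun _ _ => sq_nonneg _
  have e3 : 0 ≤ c * ∑ k ∈ Finset.Ico 0 r, (m k - m (k + 1)) ^ 2 :=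
    mul_nonneg hc.le (Finset.sum_nonneg fun _ _ => sq_nonneg _)
  have e4 : 0 ≤ c * ((m r - m (r + 1)) ^ 2 + (m (r + 1) - m (r + 2)) ^ 2
    + (m (r + 2) - m (r + 3)) ^ 2) := by positivity
  have e5 := sq_nonneg (m N)
  rw [Finset.sum_Ico_succ_top (show r + 3 ≤ N by omega)] at h1
  have e6 : 0 ≤ c * ∑ k ∈ Finset.Ico (r + 3) N, (m k - m (k + 1)) ^ 2 :=
    mul_nonneg hc.le (Finset.sum_nonneg fun _ _ => sq_nonneg _)
  have e7 := (hK (m N ^ 2) (by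
    have := sq_nonneg (1 - m r)
    have := sq_nonneg (1 - m (r + 1))
    have := sq_nonneg (1 - m (r + 2))
    linarith)).1
  nlinarith

lemma sorted_fork (h : Params t ε c κ) {K : ℕ} (hK5 : 5 ≤ K) (hK : IsLarge t κ K) {m : ℕ → ℝ}
    (hm : Antitone m) (h0 : ∀ k, 0 ≤ m k) {p n : ℕ} (hp : p ≤ 2) (hn : 2 + K ≤ n) {q : ℝ}
    (hq : 1 - m 0 - m 1 ≤ q)
    (hE : ∑ k ∈ Finset.range p, (1 - m k) ^ 2 + ∑ k ∈ Finset.Ico p n, m k ^ 2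
      + c * (∑ k ∈ Finset.range (n - 1), (m k - m (k + 1)) ^ 2 + q ^ 2) ≤ t + t⁻¹) : False := by
  obtain ⟨N, rfl⟩ : ∃ N, n = N + 1 := ⟨n - 1, by omega⟩
  have hc := h.c_pos
  have h1 := mul_last_sq_le hm h0 hn
  have h2 := h.path_sum m (show 2 ≤ N by omega)
  rw [Nat.add_sub_cancel, Finset.range_eq_Ico, Finset.range_eq_Ico,
    ← Finset.sum_Ico_consecutive _ hp (show 2 ≤ N + 1 by omega),
    ← Finset.sum_Ico_consecutive _ (show 0 ≤ 2 by omega) (show 2 ≤ N by omega)] at hE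
  have e1 : ∀ f : ℕ → ℝ, ∑ k ∈ Finset.Ico 0 2, f k = f 0 + f 1 := by
    intro f
    simp [Finset.sum_range_succ]
  rw [e1, Finset.sum_Ico_succ_top (show 2 ≤ N by omega)] at hE
  rw [Finset.sum_Ico_succ_top (show 2 ≤ N by omega)] at h1
  simp only [zero_add] at hE
  have e5 := sq_nonneg (m N)
  have e3 : 0 ≤ ∑ k ∈ Finset.Ico 2 N, (m k - m (k + 1)) ^ 2 :=
    Finset.sum_nonneg fun _ _ => sq_nonneg _
  have e4 : 0 ≤ ∑ k ∈ Finset.Ico 0 p, (1 - m k) ^ 2 := Finset.sum_nonneg fun _ _ => sq_nonneg _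
  have e6 : 0 ≤ ∑ k ∈ Finset.Ico p 2, m k ^ 2 := Finset.sum_nonneg fun _ _ => sq_nonneg _
  have e7 : 0 ≤ c * ((m 0 - m 1) ^ 2 + (m 1 - m (1 + 1)) ^ 2
      + ∑ k ∈ Finset.Ico 2 N, (m k - m (k + 1)) ^ 2 + q ^ 2) := by positivity
  have e8 := hK (m N ^ 2) (by linarith)
  have e9 : 0 ≤ c * q ^ 2 := by positivity
  have f0 := h.fork_bound (m₂ := m 2) hq
  have f1 := h.fork_bound' (m₂ := m 2) hq
  norm_num at hE
  interval_cases p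
  · simp [Finset.sum_range_succ] at hE
    nlinarith
  · simp at hE
    nlinarith
  · simp [Finset.sum_range_succ] at hE
    rcases le_total (m 1) (1 / 2) with h12 | h12
    · nlinarith
    · nlinarith [h.two_ones_bound (m₀ := m 0) (m₂ := m 2) h12]

lemma sorted_two (h : Params t ε c κ) {K : ℕ} (hK5 : 5 ≤ K) (hK : IsLarge t κ K) {m : ℕ → ℝ}
    (hm : Antitone m) (h0 : ∀ k, 0 ≤ m k) {n : ℕ} (hn : 2 + K ≤ n)
    (hE : (2 - m 0) ^ 2 + ∑ k ∈ Finset.Ico 2 n, m k ^ 2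
      + c * ∑ k ∈ Finset.range (n - 1), (m k - m (k + 1)) ^ 2 ≤ t + t⁻¹) : False := by
  obtain ⟨N, rfl⟩ : ∃ N, n = N + 1 := ⟨n - 1, by omega⟩
  have hc := h.c_pos
  have h1 := mul_last_sq_le hm h0 hn
  have h2 := h.path_sum m (show 2 ≤ N by omega)
  rw [Nat.add_sub_cancel, Finset.range_eq_Ico,
    ← Finset.sum_Ico_consecutive _ (show 0 ≤ 2 by omega) (show 2 ≤ N by omega)] at hE
  have e1 : ∀ f : ℕ → ℝ, ∑ k ∈ Finset.Ico 0 2, f k = f 0 + f 1 := by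
    intro f
    simp [Finset.sum_range_succ]
  rw [e1, Finset.sum_Ico_succ_top (show 2 ≤ N by omega)] at hE
  rw [Finset.sum_Ico_succ_top (show 2 ≤ N by omega)] at h1
  simp only [zero_add] at hE
  have e5 := sq_nonneg (m N)
  have e3 : 0 ≤ ∑ k ∈ Finset.Ico 2 N, (m k - m (k + 1)) ^ 2 :=
    Finset.sum_nonneg fun _ _ => sq_nonneg _
  have e7 : 0 ≤ c * ((m 0 - m 1) ^ 2 + (m 1 - m (1 + 1)) ^ 2
      + ∑ k ∈ Finset.Ico 2 N, (m k - m (k + 1)) ^ 2) := by positivity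
  have e8 := hK (m N ^ 2) (by linarith [sq_nonneg (2 - m 0)])
  norm_num at hE
  nlinarith [h.height_two_bound (m 0) (m 1) (m 2)]

end Params

lemma sum_le_sum_range_card {q : ℕ → ℝ} (hq : Antitone q) (S : Finset ℕ) :
    ∑ k ∈ S, q k ≤ ∑ k ∈ Finset.range S.card, q k := by
  have h1 : ∑ k ∈ S, (q k - q (S.card - 1))
      ≤ ∑ k ∈ Finset.range S.card, (q k - q (S.card - 1)) := by
    rw [← Finset.sum_inter_add_sum_sdiff S (Finset.range S.card),
      ← Finset.sum_inter_add_sum_sdiff (Finset.range S.card) S, Finset.inter_comm]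
    refine add_le_add le_rfl ?_
    refine le_trans (Finset.sum_nonpos fun k hk => ?_) (Finset.sum_nonneg fun k hk => ?_)
    · simp only [Finset.mem_sdiff, Finset.mem_range, not_lt] at hk
      linarith [hq (show S.card - 1 ≤ k by omega)]
    · simp only [Finset.mem_sdiff, Finset.mem_range] at hk
      linarith [hq (show k ≤ S.card - 1 by omega)]
  simpa [Finset.sum_sub_distrib] using h1

lemma sum_sq_gap_le {α : Type*} (X : Finset α) (r : α → ℝ) {m : ℕ → ℝ} (hm : Antitone m) (N : ℕ)
    (cr : α → ℕ → Prop) (hcr : ∀ k < N, ∃ x ∈ X, cr x k)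
    (hr : ∀ x ∈ X, ∃ a b, (∀ k, cr x k → a ≤ k ∧ k < b) ∧ (m a - m b) ^ 2 ≤ r x) :
    ∑ k ∈ Finset.range N, (m k - m (k + 1)) ^ 2 ≤ ∑ x ∈ X, r x := by
  calc ∑ k ∈ Finset.range N, (m k - m (k + 1)) ^ 2
      ≤ ∑ k ∈ Finset.range N, ∑ x ∈ X, if cr x k then (m k - m (k + 1)) ^ 2 else 0 := by
        refine Finset.sum_le_sum fun k hk => ?_
        obtain ⟨x, hx, hxk⟩ := hcr k (Finset.mem_range.1 hk)
        refine le_trans (le_of_eq ?_) (Finset.single_le_sum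
          (f := fun x => if cr x k then (m k - m (k + 1)) ^ 2 else 0) (fun y _ => ?_) hx)
        · simp [hxk]
        · split_ifs <;> positivity
    _ = ∑ x ∈ X, ∑ k ∈ Finset.range N, if cr x k then (m k - m (k + 1)) ^ 2 else 0 :=
        Finset.sum_comm
    _ ≤ ∑ x ∈ X, r x := by
        refine Finset.sum_le_sum fun x hx => ?_
        obtain ⟨a, b, hab, hle⟩ := hr x hx
        refine le_trans ?_ hle
        rw [← Finset.sum_filter]
        calc ∑ k ∈ Finset.range N with cr x k, (m k - m (k + 1)) ^ 2
            ≤ ∑ k ∈ Finset.Ico a b, (m k - m (k + 1)) ^ 2 := by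
              refine Finset.sum_le_sum_of_subset_of_nonneg (fun k hk => ?_)
                fun _ _ _ => sq_nonneg _
              rw [Finset.mem_Ico]
              exact hab k (Finset.mem_filter.1 hk).2
          _ ≤ (m a - m b) ^ 2 := by
              rcases le_total b a with h | h
              · simp [Finset.Ico_eq_empty_of_le h, sq_nonneg]
              · refine (Finset.sum_sq_le_sq_sum_of_nonneg fun k _ =>
                  sub_nonneg.2 (hm (Nat.le_succ k))).trans (le_of_eq ?_)
                have h3 : ∑ k ∈ Finset.Ico a b, (m k - m (k + 1)) = m a - m b := by
                  rw [← neg_inj, ← Finset.sum_neg_distrib]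
                  simpa using Finset.sum_Ico_sub m h
                rw [h3]

section TwoSupport

variable {ι : Type*} [Fintype ι] {v : ι → ℤ}

lemma two_support (hv : ∑ i, v i ^ 2 = 2) {i j : ι} (hij : i ≠ j) (hi : v i ≠ 0) (hj : v j ≠ 0) :
    v i ^ 2 = 1 ∧ v j ^ 2 = 1 ∧ ∀ k, k ≠ i → k ≠ j → v k = 0 := by
  have hp : ∀ k, v k ≠ 0 → 1 ≤ v k ^ 2 := fun k hk => by
    have := sq_pos_of_ne_zero hk
    omega
  have h1 : ∀ s : Finset ι, ∑ k ∈ s, v k ^ 2 ≤ 2 := fun s =>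
    hv ▸ Finset.sum_le_sum_of_subset_of_nonneg (Finset.subset_univ s) fun _ _ _ => sq_nonneg _
  have h2 := h1 {i, j}
  rw [Finset.sum_pair hij] at h2
  have := hp i hi
  have := hp j hj
  refine ⟨by omega, by omega, fun k hki hkj => ?_⟩
  by_contra hk
  have h3 := h1 {k, i, j}
  rw [Finset.sum_insert (by simp [hki, hkj]), Finset.sum_pair hij] at h3
  have := hp k hk
  omega

lemma exists_two_support (hv : ∑ i, v i ^ 2 = 2) : ∃ i j, i ≠ j ∧ v i ≠ 0 ∧ v j ≠ 0 := by
  obtain ⟨i, hi⟩ : ∃ i, v i ≠ 0 := by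
    by_contra! h
    simp [h] at hv
  by_contra! h
  have h1 : ∑ j, v j ^ 2 = v i ^ 2 := Finset.sum_eq_single i
    (fun j _ hj => by simp [h i j hj.symm hi]) (by simp)
  rw [hv] at h1
  have h2 : |v i| < 2 := by
    by_contra! h2
    nlinarith [sq_abs (v i)]
  rw [← sq_abs] at h1
  have := abs_nonneg (v i)
  interval_cases |v i| <;> omega

lemma two_support_sum (hv : ∑ i, v i ^ 2 = 2) {i j : ι} (hij : i ≠ j) (hi : v i ≠ 0) (hj : v j ≠ 0)
    (h : ι → ℝ) : ∑ k, (v k : ℝ) * h k = v i * h i + v j * h j := by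
  rw [← Finset.sum_pair hij (f := fun k => (v k : ℝ) * h k)]
  refine (Finset.sum_subset (Finset.subset_univ _) fun k _ hk => ?_).symm
  simp only [Finset.mem_insert, Finset.mem_singleton, not_or] at hk
  simp [(two_support hv hij hi hj).2.2 k hk.1 hk.2]

end TwoSupport

/-- Every nontrivial cut of the coordinates is crossed by the support of some vector. -/
def Crossing {V ι : Type*} [Fintype ι] (X : Finset V) (φ : V → ι → ℤ) : Prop :=
  ∀ S : Finset ι, S.Nonempty → S ≠ Finset.univ →
    ∃ x ∈ X, ∃ i ∈ S, ∃ j ∉ S, φ x i ≠ 0 ∧ φ x j ≠ 0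

lemma exists_profile {V : Type*} {n : ℕ} {X : Finset V} {φ : V → Fin n → ℤ}
    (hnorm : ∀ x ∈ X, ∑ i, φ x i ^ 2 = 2) (hcross : Crossing X φ)
    {g : Fin n → ℝ} (hg : ∀ i, 0 ≤ g i) {r : V → ℝ}
    (hr : ∀ x ∈ X, ∀ i j, i ≠ j → φ x i ≠ 0 → φ x j ≠ 0 → (g i - g j) ^ 2 ≤ r x) :
    ∃ (m : ℕ → ℝ) (ρ : Fin n ≃ Fin n), Antitone m ∧ (∀ k, 0 ≤ m k) ∧ (∀ i, g i = m (ρ i)) ∧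
      ∑ k ∈ Finset.range (n - 1), (m k - m (k + 1)) ^ 2 ≤ ∑ x ∈ X, r x := by
  obtain ⟨σ, hσ⟩ : ∃ σ : Equiv.Perm (Fin n), Antitone (g ∘ σ) := by
    refine ⟨Tuple.sort fun i => -g i, fun a b hab => ?_⟩
    have := Tuple.monotone_sort (fun i => -g i) hab
    simpa using this
  have hm0 : ∀ k, 0 ≤ (fun k : ℕ => if h : k < n then g (σ ⟨k, h⟩) else 0) k := by
    intro k
    dsimp only
    split_ifs
    · exact hg _
    · exact le_rfl
  have hm : Antitone fun k : ℕ => if h : k < n then g (σ ⟨k, h⟩) else 0 := by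
    intro a b hab
    by_cases hb : b < n
    · have ha : a < n := by omega
      simp only [ha, hb, dif_pos]
      exact hσ (show (⟨a, ha⟩ : Fin n) ≤ ⟨b, hb⟩ from hab)
    · have := hm0 a
      simpa only [hb, dif_neg, not_false_iff] using this
  have hgm : ∀ i, g i = (fun k : ℕ => if h : k < n then g (σ ⟨k, h⟩) else 0) (σ.symm i) := by
    intro i
    simp
  generalize (fun k : ℕ => if h : k < n then g (σ ⟨k, h⟩) else 0) = m at *
  refine ⟨m, σ.symm, hm, hm0, hgm, ?_⟩
  refine sum_sq_gap_le X r hm (n - 1) (fun x k => ∃ i j, φ x i ≠ 0 ∧ φ x j ≠ 0 ∧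
    (σ.symm i : ℕ) ≤ k ∧ k < σ.symm j) (fun k hk => ?_) fun x hx => ?_
  · obtain ⟨x, hx, i, hi, j, hj, hxi, hxj⟩ := hcross
      (Finset.univ.filter fun i => (σ.symm i : ℕ) ≤ k)
      ⟨σ ⟨0, by omega⟩, by simp⟩
      (fun h => by
        have := h ▸ Finset.mem_univ (σ ⟨k + 1, by omega⟩)
        simp at this)
    simp only [Finset.mem_filter, Finset.mem_univ, true_and, not_le] at hi hj
    exact ⟨x, hx, i, j, hxi, hxj, hi, hj⟩
  · obtain ⟨i, j, hij, hi, hj⟩ := exists_two_support (hnorm x hx)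
    have hs := (two_support (hnorm x hx) hij hi hj).2.2
    have hmem : ∀ k, φ x k ≠ 0 → k = i ∨ k = j := fun k hk => by
      by_contra! h
      exact hk (hs k h.1 h.2)
    have h2 := hr x hx i j hij hi hj
    rw [hgm i, hgm j] at h2
    rcases le_total (σ.symm i : ℕ) (σ.symm j) with hle | hle
    · refine ⟨σ.symm i, σ.symm j, ?_, h2⟩
      rintro k ⟨a, b, ha, hb, hak, hkb⟩
      rcases hmem a ha with rfl | rfl <;> rcases hmem b hb with rfl | rfl <;> omega
    · refine ⟨σ.symm j, σ.symm i, ?_, by rwa [← neg_sub, neg_sq]⟩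
      rintro k ⟨a, b, ha, hb, hak, hkb⟩
      rcases hmem a ha with rfl | rfl <;> rcases hmem b hb with rfl | rfl <;> omega

section Rearrangement

variable {n : ℕ} {g : Fin n → ℝ} {m : ℕ → ℝ} {ρ : Fin n ≃ Fin n}

lemma sum_rank_eq (hgm : ∀ i, g i = m (ρ i)) (F : ℝ → ℝ) :
    ∑ i, F (g i) = ∑ k ∈ Finset.range n, F (m k) := by
  simp only [hgm]
  rw [Equiv.sum_comp ρ fun i : Fin n => F (m i), Finset.sum_range]

lemma sum_rank_le (hgm : ∀ i, g i = m (ρ i)) {F : ℝ → ℝ} (hF : Antitone fun k => F (m k))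
    (S : Finset (Fin n)) : ∑ i ∈ S, F (g i) ≤ ∑ k ∈ Finset.range S.card, F (m k) := by
  have h := sum_le_sum_range_card hF (S.map (ρ.toEmbedding.trans Fin.valEmbedding))
  rw [Finset.card_map, Finset.sum_map] at h
  simpa [hgm] using h

lemma card_le_of_finset (S : Finset (Fin n)) : S.card ≤ n := by
  simpa using Finset.card_le_univ S

lemma sorted_le_sum_indicator (hm : Antitone m) (hgm : ∀ i, g i = m (ρ i)) (S : Finset (Fin n)) :
    ∑ k ∈ Finset.range S.card, (1 - m k) ^ 2 + ∑ k ∈ Finset.Ico S.card n, m k ^ 2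
      ≤ ∑ i, ((if i ∈ S then 1 else 0) - g i) ^ 2 := by
  have h1 := sum_rank_eq hgm fun x => x ^ 2
  have h2 := sum_rank_le (F := fun x => x) hgm hm S
  have h3 : ∀ i, ((if i ∈ S then 1 else 0) - g i) ^ 2
      = g i ^ 2 + (if i ∈ S then (1 - 2 * g i) else 0) := by
    intro i
    split_ifs <;> ring
  have h4 : ∀ k, (1 - m k) ^ 2 = m k ^ 2 + (1 - 2 * m k) := fun k => by ring
  simp only [h3, h4, Finset.sum_add_distrib, ← Finset.sum_filter, Finset.filter_mem_eq_inter,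
    Finset.univ_inter, Finset.sum_sub_distrib, ← Finset.mul_sum]
  rw [Finset.range_eq_Ico] at h1
  rw [h1, ← Finset.sum_Ico_consecutive _ (Nat.zero_le S.card) (card_le_of_finset S)]
  simp only [← Finset.range_eq_Ico, Finset.sum_const, Finset.card_range, nsmul_one] at h2 ⊢
  linarith

lemma sorted_le_sum_compl (hm : Antitone m) (h0 : ∀ k, 0 ≤ m k) (hgm : ∀ i, g i = m (ρ i))
    (S : Finset (Fin n)) : ∑ k ∈ Finset.Ico S.card n, m k ^ 2 ≤ ∑ i ∈ Sᶜ, g i ^ 2 := by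
  have h1 := sum_rank_eq hgm fun x => x ^ 2
  have h2 := sum_rank_le (F := fun x => x ^ 2) hgm (fun a b hab => by
    have := hm hab
    have := h0 b
    dsimp only
    gcongr) S
  rw [Finset.range_eq_Ico, ← Finset.sum_Ico_consecutive _ (Nat.zero_le S.card)
    (card_le_of_finset S), ← Finset.sum_add_sum_compl S] at h1
  rw [Finset.range_eq_Ico] at h2
  linarith

end Rearrangement

section Truncation

lemma clamp_lipschitz (k a b : ℝ) :
    |max 0 (min 1 (a - k)) - max 0 (min 1 (b - k))| ≤ |a - b| := by
  grind (splits := 30)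

lemma one_sub_clamp {k a y : ℝ} (hy : k + 1 ≤ y) : |1 - max 0 (min 1 (a - k))| ≤ |y - a| := by
  grind

lemma zero_sub_clamp {k a y : ℝ} (hy : y ≤ k) : |0 - max 0 (min 1 (a - k))| ≤ |y - a| := by
  grind

lemma clamp_lipschitz' (k a b : ℝ) :
    |max 0 (min 1 (k - a)) - max 0 (min 1 (k - b))| ≤ |a - b| := by
  grind (splits := 30)

lemma one_sub_clamp' {k a y : ℝ} (hy : y + 1 ≤ k) : |1 - max 0 (min 1 (k - a))| ≤ |y - a| := by
  grind

lemma zero_sub_clamp' {k a y : ℝ} (hy : k ≤ y) : |0 - max 0 (min 1 (k - a))| ≤ |y - a| := by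
  grind

lemma min_abs_lipschitz (z a b : ℝ) : |min |a| z - min |b| z| ≤ |a - b| := by
  grind (splits := 30)

lemma one_sub_min_abs {a y : ℝ} (hy : 1 ≤ |y|) : |1 - min |a| 1| ≤ |y - a| := by
  grind

lemma zero_sub_min_abs {a y z : ℝ} (hz : 0 ≤ z) (hy : y = 0) : |0 - min |a| z| ≤ |y - a| := by
  grind

lemma two_sub_le {a y m : ℝ} (hy : 2 ≤ |y|) (hm : min |a| 2 ≤ m) (hm2 : m ≤ 2) :
    |2 - m| ≤ |y - a| := by
  grind

end Truncation

section Rigidity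

variable {t ε c κ : ℝ} {K n : ℕ} {V : Type*} {T : Finset V} {φ : V → Fin n → ℤ}
  {f : Fin n → ℤ} {h : Fin n → ℝ}

lemma balanced_pair {v : Fin n → ℤ} (hv : ∑ i, v i ^ 2 = 2) (hb : ∑ i, v i = 0)
    {i j : Fin n} (hij : i ≠ j) (hi : v i ≠ 0) (hj : v j ≠ 0) (h : Fin n → ℝ) :
    (∑ k, (v k : ℝ) * h k) ^ 2 = (h i - h j) ^ 2 := by
  have h1 := two_support_sum hv hij hi hj h
  have h2 := two_support_sum hv hij hi hj fun _ => 1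
  have h3 := (two_support hv hij hi hj).1
  have h4 : (∑ k, (v k : ℝ) * 1) = 0 := by
    simp only [mul_one]
    exact_mod_cast hb
  have h5 : (v i : ℝ) ^ 2 = 1 := by exact_mod_cast h3
  have h6 : (v j : ℝ) = -v i := by linarith
  rw [h1, h6]
  linear_combination (h i - h j) ^ 2 * h5

/-- A nonnegative `1`-Lipschitz truncation of `h`, sorted, has no larger gap energy than `h`. -/
lemma exists_truncated_profile (hnorm : ∀ x ∈ T, ∑ i, φ x i ^ 2 = 2) (hcross : Crossing T φ)
    (hbal : ∀ x ∈ T, ∑ i, φ x i = 0) (h : Fin n → ℝ) {F : ℝ → ℝ} (hF0 : ∀ a, 0 ≤ F a)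
    (hF : ∀ a b, |F a - F b| ≤ |a - b|) :
    ∃ (m : ℕ → ℝ) (ρ : Fin n ≃ Fin n), Antitone m ∧ (∀ k, 0 ≤ m k) ∧ (∀ i, F (h i) = m (ρ i)) ∧
      ∑ k ∈ Finset.range (n - 1), (m k - m (k + 1)) ^ 2
        ≤ ∑ x ∈ T, (∑ i, (φ x i : ℝ) * h i) ^ 2 := by
  refine exists_profile hnorm hcross (fun i => hF0 (h i)) fun x hx i j hij hi hj => ?_
  rw [balanced_pair (hnorm x hx) (hbal x hx) hij hi hj]
  exact sq_le_sq.2 (hF _ _)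

lemma false_of_level (P : Params t ε c κ) (hK5 : 5 ≤ K) (hK : IsLarge t κ K)
    (hnorm : ∀ x ∈ T, ∑ i, φ x i ^ 2 = 2) (hcross : Crossing T φ)
    (hbal : ∀ x ∈ T, ∑ i, φ x i = 0)
    (hE : ∑ i, (f i - h i) ^ 2 + c * ∑ x ∈ T, (∑ i, (φ x i : ℝ) * h i) ^ 2 ≤ t + t⁻¹)
    {F : ℝ → ℝ} (hF0 : ∀ a, 0 ≤ F a) (hF : ∀ a b, |F a - F b| ≤ |a - b|) {S : Finset (Fin n)}
    (hS : ∀ i, |(if i ∈ S then 1 else 0) - F (h i)| ≤ |f i - h i|)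
    (h3 : 3 ≤ S.card) (hn : S.card + K ≤ n) : False := by
  obtain ⟨m, ρ, hm, h0, hgm, hle⟩ := exists_truncated_profile hnorm hcross hbal h hF0 hF
  refine P.sorted_three hK5 hK hm h0 h3 hn (le_trans (add_le_add ?_ ?_) hE)
  · exact (sorted_le_sum_indicator hm hgm S).trans
      (Finset.sum_le_sum fun i _ => sq_le_sq.2 (hS i))
  · exact mul_le_mul_of_nonneg_left hle P.c_pos.le

lemma level_small_or_large (P : Params t ε c κ) (hK5 : 5 ≤ K) (hK : IsLarge t κ K)
    (hnorm : ∀ x ∈ T, ∑ i, φ x i ^ 2 = 2) (hcross : Crossing T φ)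
    (hbal : ∀ x ∈ T, ∑ i, φ x i = 0)
    (hE : ∑ i, (f i - h i) ^ 2 + c * ∑ x ∈ T, (∑ i, (φ x i : ℝ) * h i) ^ 2 ≤ t + t⁻¹)
    (hn : 2 * K ≤ n) (k : ℤ) :
    (Finset.univ.filter fun i => k < f i).card ≤ 2 ∨
      (Finset.univ.filter fun i => ¬ k < f i).card ≤ 2 := by
  have hcard := Finset.card_filter_add_card_filter_not (s := Finset.univ) fun i => k < f i
  rw [Finset.card_univ, Fintype.card_fin] at hcard
  by_contra hc
  rw [not_or, not_le, not_le] at hc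
  rcases le_total ((Finset.univ.filter fun i => k < f i).card + K) n with h1 | h1
  · refine false_of_level P hK5 hK hnorm hcross hbal hE (F := fun a => max 0 (min 1 (a - k)))
      (fun a => le_max_left _ _) (fun a b => ?_) (fun i => ?_) hc.1 h1
    · exact clamp_lipschitz k a b
    · simp only [Finset.mem_filter, Finset.mem_univ, true_and]
      split_ifs with hi
      · exact one_sub_clamp (by exact_mod_cast hi)
      · exact zero_sub_clamp (by exact_mod_cast not_lt.1 hi)
  · refine false_of_level P hK5 hK hnorm hcross hbal hE (F := fun a => max 0 (min 1 (k + 1 - a)))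
      (fun a => le_max_left _ _) (fun a b => ?_) (fun i => ?_) hc.2 (by omega)
    · exact clamp_lipschitz' (k + 1) a b
    · simp only [Finset.mem_filter, Finset.mem_univ, true_and]
      split_ifs with hi
      · exact zero_sub_clamp' (by exact_mod_cast hi)
      · exact one_sub_clamp' (by exact_mod_cast Int.add_le_add_right (not_lt.1 hi) 1)

lemma exists_central_level (P : Params t ε c κ) (hK5 : 5 ≤ K) (hK : IsLarge t κ K)
    (hnorm : ∀ x ∈ T, ∑ i, φ x i ^ 2 = 2) (hcross : Crossing T φ)
    (hbal : ∀ x ∈ T, ∑ i, φ x i = 0)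
    (hE : ∑ i, (f i - h i) ^ 2 + c * ∑ x ∈ T, (∑ i, (φ x i : ℝ) * h i) ^ 2 ≤ t + t⁻¹)
    (hn : 2 * K ≤ n) :
    ∃ k : ℤ, (Finset.univ.filter fun i => f i ≠ k).card ≤ 4 := by
  have hdich := level_small_or_large P hK5 hK hnorm hcross hbal hE hn
  have hne : (Finset.univ : Finset (Fin n)).Nonempty := ⟨⟨0, by omega⟩, Finset.mem_univ _⟩
  obtain ⟨lo, hlo⟩ : ∃ lo : ℤ, ∀ i, lo < f i :=
    ⟨Finset.univ.inf' hne f - 1, fun i => by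
      have := Finset.inf'_le f (Finset.mem_univ i)
      omega⟩
  obtain ⟨hi, hhi⟩ : ∃ hi : ℤ, ∀ i, f i ≤ hi :=
    ⟨Finset.univ.sup' hne f, fun i => Finset.le_sup' f (Finset.mem_univ i)⟩
  obtain ⟨k, hk, hmax⟩ := Int.exists_greatest_of_bdd
    (P := fun k => (Finset.univ.filter fun i => ¬ k < f i).card ≤ 2)
    ⟨hi, fun z hz => by
      by_contra! hlt
      have : (Finset.univ.filter fun i => ¬ z < f i) = Finset.univ := by
        ext i
        have := hhi i
        simp
        omega
      simp only [this, Finset.card_univ, Fintype.card_fin] at hz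
      omega⟩
    ⟨lo, by simp [hlo]⟩
  have hk1 : (Finset.univ.filter fun i => k + 1 < f i).card ≤ 2 := by
    rcases hdich (k + 1) with h1 | h1
    · exact h1
    · have := hmax _ h1
      omega
  refine ⟨k + 1, le_trans (Finset.card_le_card ?_) ((Finset.card_union_le _ _).trans
    (Nat.add_le_add hk hk1))⟩
  intro i hi
  simp only [Finset.mem_filter, Finset.mem_univ, true_and, Finset.mem_union] at hi ⊢
  omega

lemma card_support_le_two (P : Params t ε c κ) (hK5 : 5 ≤ K) (hK : IsLarge t κ K)
    (hnorm : ∀ x ∈ T, ∑ i, φ x i ^ 2 = 2) (hcross : Crossing T φ)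
    (hbal : ∀ x ∈ T, ∑ i, φ x i = 0)
    (hE : ∑ i, (f i - h i) ^ 2 + c * ∑ x ∈ T, (∑ i, (φ x i : ℝ) * h i) ^ 2 ≤ t + t⁻¹)
    (hn : 2 * K ≤ n) (h4 : (Finset.univ.filter fun i => f i ≠ 0).card ≤ 4) :
    (Finset.univ.filter fun i => f i ≠ 0).card ≤ 2 := by
  by_contra! h3
  refine false_of_level P hK5 hK hnorm hcross hbal hE (F := fun a => min |a| 1)
    (fun a => by positivity) (min_abs_lipschitz 1) (fun i => ?_) h3 (by omega)
  simp only [Finset.mem_filter, Finset.mem_univ, true_and]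
  split_ifs with hi
  · exact one_sub_min_abs (by exact_mod_cast Int.one_le_abs hi)
  · exact zero_sub_min_abs zero_le_one (by exact_mod_cast not_not.1 hi)

lemma abs_le_one_of_card_support (P : Params t ε c κ) (hK5 : 5 ≤ K) (hK : IsLarge t κ K)
    (hnorm : ∀ x ∈ T, ∑ i, φ x i ^ 2 = 2) (hcross : Crossing T φ)
    (hbal : ∀ x ∈ T, ∑ i, φ x i = 0)
    (hE : ∑ i, (f i - h i) ^ 2 + c * ∑ x ∈ T, (∑ i, (φ x i : ℝ) * h i) ^ 2 ≤ t + t⁻¹)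
    (hn : 2 * K ≤ n) (h2 : (Finset.univ.filter fun i => f i ≠ 0).card ≤ 2) (i : Fin n) :
    |f i| ≤ 1 := by
  by_contra! hi
  obtain ⟨m, ρ, hm, h0, hgm, hle⟩ := exists_truncated_profile hnorm hcross hbal h
    (F := fun a => min |a| 2) (fun a => by positivity) (min_abs_lipschitz 2)
  set S := Finset.univ.filter fun i => f i ≠ 0 with hS
  refine P.sorted_two hK5 hK hm h0 (by omega) (le_trans (add_le_add ?_
    (mul_le_mul_of_nonneg_left hle P.c_pos.le)) hE)
  rw [← Finset.sum_add_sum_compl S]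
  refine add_le_add ?_ (le_trans (Finset.sum_le_sum_of_subset_of_nonneg
    (Finset.Ico_subset_Ico_left h2) fun _ _ _ => sq_nonneg _) ((sorted_le_sum_compl hm h0 hgm S).trans
      (Finset.sum_le_sum fun j hj => ?_)))
  · have hiS : i ∈ S := by
      rw [hS, Finset.mem_filter]
      refine ⟨Finset.mem_univ _, fun h0 => ?_⟩
      simp [h0] at hi
    refine le_trans ?_ (Finset.single_le_sum (f := fun i => ((f i : ℝ) - h i) ^ 2)
      (fun _ _ => sq_nonneg _) hiS)
    have h5 := hgm (ρ.symm ⟨0, i.pos⟩)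
    simp only [Equiv.apply_symm_apply] at h5
    have h6 : m (ρ i) ≤ m 0 := hm (Nat.zero_le _)
    rw [← hgm i] at h6
    have h7 : (2 : ℝ) ≤ |(f i : ℝ)| := by exact_mod_cast hi
    exact sq_le_sq.2 (two_sub_le h7 h6 (h5 ▸ min_le_right _ _))
  · have h8 : (f j : ℝ) = 0 := by simpa [hS] using hj
    have h9 := sq_le_sq.2 (zero_sub_min_abs zero_le_two h8 (a := h j))
    rwa [zero_sub, neg_sq] at h9

lemma exact_of_small_support (P : Params t ε c κ) (hK5 : 5 ≤ K) (hK : IsLarge t κ K)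
    (hnorm : ∀ x ∈ T, ∑ i, φ x i ^ 2 = 2) (hcross : Crossing T φ)
    (hbal : ∀ x ∈ T, ∑ i, φ x i = 0) {w : Fin n → ℤ} (hw : ∑ i, w i ^ 2 = 2) {b : ℤ}
    (hE : ∑ i, (f i - h i) ^ 2 + c * (∑ x ∈ T, (∑ i, (φ x i : ℝ) * h i) ^ 2
      + (b - ∑ i, (w i : ℝ) * (f i - h i)) ^ 2) ≤ t + t⁻¹)
    (hn : 2 * K ≤ n) (h2 : (Finset.univ.filter fun i => f i ≠ 0).card ≤ 2)
    (h1 : ∀ i, |f i| ≤ 1) : ∑ i, w i * f i = b := by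
  by_contra hne
  obtain ⟨m, ρ, hm, h0, hgm, hle⟩ := exists_truncated_profile hnorm hcross hbal h
    (F := fun a => |a|) (fun a => abs_nonneg a) (fun a b => abs_abs_sub_abs_le a b)
  obtain ⟨i, j, hij, hi, hj⟩ := exists_two_support hw
  refine P.sorted_fork hK5 hK hm h0 h2 (by omega)
    (q := |b - ∑ i, (w i : ℝ) * (f i - h i)|) ?_ (le_trans (add_le_add ?_
      (mul_le_mul_of_nonneg_left (add_le_add hle (sq_abs _).le) P.c_pos.le)) hE)
  · have h3 := sum_rank_le (F := fun x => x) hgm hm {i, j}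
    rw [Finset.card_pair hij, Finset.sum_pair hij] at h3
    simp only [Finset.sum_range_succ, Finset.range_zero, Finset.sum_empty, zero_add] at h3
    have h4 : (1 : ℝ) ≤ |(b : ℝ) - ∑ i, (w i : ℝ) * f i| := by
      exact_mod_cast Int.one_le_abs (sub_ne_zero.2 (Ne.symm hne))
    have h5 : ∑ i, (w i : ℝ) * (f i - h i) = ∑ i, (w i : ℝ) * f i - ∑ i, (w i : ℝ) * h i := by
      simp [mul_sub]
    have h6 := two_support_sum hw hij hi hj h
    have h7 := two_support hw hij hi hj
    have habs : ∀ z : ℤ, z ^ 2 = 1 → |(z : ℝ)| = 1 := fun z hz => by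
      rw [← abs_one, ← sq_eq_sq_iff_abs_eq_abs]
      exact_mod_cast hz
    have h8 : |(w i : ℝ) * h i| = |h i| := by
      rw [abs_mul, habs _ h7.1, one_mul]
    have h9 : |(w j : ℝ) * h j| = |h j| := by
      rw [abs_mul, habs _ h7.2.1, one_mul]
    have h10 := abs_add_le ((w i : ℝ) * h i) (w j * h j)
    have h11 := abs_sub_abs_le_abs_sub ((b : ℝ) - ∑ i, (w i : ℝ) * f i) (-∑ i, (w i : ℝ) * h i)
    rw [abs_neg, h6, sub_neg_eq_add] at h11
    rw [h5, h6, sub_sub_eq_add_sub, add_sub_right_comm]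
    rw [hgm i, hgm j] at *
    linarith
  · refine (sorted_le_sum_indicator hm hgm _).trans
      (Finset.sum_le_sum fun i _ => sq_le_sq.2 ?_)
    simp only [Finset.mem_filter, Finset.mem_univ, true_and]
    split_ifs with hi
    · have : |(f i : ℝ)| = 1 := by
        exact_mod_cast le_antisymm (h1 i) (Int.one_le_abs hi)
      rw [← this]
      exact abs_abs_sub_abs_le _ _
    · have : (f i : ℝ) = 0 := by exact_mod_cast not_not.1 hi
      simp [this]

end Rigidity

lemma exists_integral_solution {t ε c κ : ℝ} {K n : ℕ} {V : Type*} {W T : Finset V}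
    {φ : V → Fin n → ℤ} (P : Params t ε c κ) (hK5 : 5 ≤ K) (hK : IsLarge t κ K)
    (hn : 2 * K ≤ n) (hTW : T ⊆ W) (hnorm : ∀ x ∈ W, ∑ i, φ x i ^ 2 = 2)
    (hcross : Crossing T φ) (hbal : ∀ x ∈ T, ∑ i, φ x i = 0) {b : V → ℤ} {u : Fin n → ℝ}
    (hu : ∑ i, u i ^ 2 + c * ∑ x ∈ W, (b x - ∑ i, (φ x i : ℝ) * u i) ^ 2 ≤ t + t⁻¹)
    (hsolve : ∃ f : Fin n → ℤ, ∀ x ∈ T, ∑ i, φ x i * f i = b x) :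
    ∃ f : Fin n → ℤ, (∀ i, |f i| ≤ 1) ∧ (Finset.univ.filter fun i => f i ≠ 0).card ≤ 2 ∧
      ∀ x ∈ W, ∑ i, φ x i * f i = b x := by
  have hnT : ∀ x ∈ T, ∑ i, φ x i ^ 2 = 2 := fun x hx => hnorm x (hTW hx)
  have hsum : ∀ f : Fin n → ℤ, (∀ x ∈ T, ∑ i, φ x i * f i = b x) →
      ∑ x ∈ T, (∑ i, (φ x i : ℝ) * (f i - u i)) ^ 2
        = ∑ x ∈ T, (b x - ∑ i, (φ x i : ℝ) * u i) ^ 2 := by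
    intro f hf
    refine Finset.sum_congr rfl fun x hx => ?_
    have : ∑ i, (φ x i : ℝ) * f i = b x := by exact_mod_cast hf x hx
    simp only [mul_sub, Finset.sum_sub_distrib, this]
  have hE : ∀ f : Fin n → ℤ, (∀ x ∈ T, ∑ i, φ x i * f i = b x) →
      ∑ i, (f i - (f i - u i)) ^ 2
        + c * ∑ x ∈ T, (∑ i, (φ x i : ℝ) * (f i - u i)) ^ 2 ≤ t + t⁻¹ := by
    intro f hf
    simp only [sub_sub_cancel, hsum f hf]
    refine le_trans (add_le_add le_rfl (mul_le_mul_of_nonneg_left ?_ P.c_pos.le)) hu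
    exact Finset.sum_le_sum_of_subset_of_nonneg hTW fun _ _ _ => sq_nonneg _
  obtain ⟨f, hf⟩ := hsolve
  obtain ⟨k, hk⟩ := exists_central_level P hK5 hK hnT hcross hbal (hE f hf) hn
  have hg : ∀ x ∈ T, ∑ i, φ x i * (f i - k) = b x := fun x hx => by
    simp only [mul_sub, Finset.sum_sub_distrib, ← Finset.sum_mul, hbal x hx, hf x hx, zero_mul,
      sub_zero]
  have h4 : (Finset.univ.filter fun i => f i - k ≠ 0).card ≤ 4 := by
    simpa only [sub_ne_zero] using hk
  have h2 := card_support_le_two P hK5 hK hnT hcross hbal (hE _ hg) hn h4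
  have h1 := abs_le_one_of_card_support P hK5 hK hnT hcross hbal (hE _ hg) hn h2
  refine ⟨fun i => f i - k, h1, h2, fun x hx => ?_⟩
  by_cases hxT : x ∈ T
  · exact hg x hxT
  refine exact_of_small_support P hK5 hK hnT hcross hbal (h := fun i => ((f i - k : ℤ) : ℝ) - u i)
    (hnorm x hx) ?_ hn h2 h1
  have h3 : ∑ y ∈ T, (b y - ∑ i, (φ y i : ℝ) * u i) ^ 2 + (b x - ∑ i, (φ x i : ℝ) * u i) ^ 2
      ≤ ∑ y ∈ W, (b y - ∑ i, (φ y i : ℝ) * u i) ^ 2 := by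
    rw [add_comm, ← Finset.sum_insert (f := fun y => (b y - ∑ i, (φ y i : ℝ) * u i) ^ 2) hxT]
    exact Finset.sum_le_sum_of_subset_of_nonneg (Finset.insert_subset hx hTW)
      fun _ _ _ => sq_nonneg _
  rw [hsum _ hg]
  simp only [sub_sub_cancel]
  exact le_trans (add_le_add le_rfl (mul_le_mul_of_nonneg_left h3 P.c_pos.le)) hu

/-- Regularised least squares: `z` solves `(N Nᵀ + ε) z = b` and `u = Nᵀ z`. -/
lemma exists_energy_minimizer {V ι : Type*} [Fintype V] [Fintype ι] (N : V → ι → ℝ) (b : V → ℝ)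
    {ε c L : ℝ} (hε : 0 < ε) (hc : c * ε = 1)
    (hform : ∀ z : V → ℝ, 2 * ∑ x, b x * z x
      ≤ ∑ i, (∑ x, N x i * z x) ^ 2 + ε * ∑ x, z x ^ 2 + L) :
    ∃ u : ι → ℝ, ∑ i, u i ^ 2 + c * ∑ x, (b x - ∑ i, N x i * u i) ^ 2 ≤ L := by
  let M : (V → ℝ) →ₗ[ℝ] (V → ℝ) :=
    Matrix.toLin' (Matrix.of N * (Matrix.of N).transpose) + ε • LinearMap.id
  have hM : ∀ z x, M z x = ∑ i, N x i * ∑ y, N y i * z y + ε * z x := by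
    intro z x
    simp [M, -Matrix.mulVec_mulVec, Matrix.mulVec, dotProduct]
  have hquad : ∀ z : V → ℝ, ∑ x, M z x * z x = ∑ i, (∑ x, N x i * z x) ^ 2 + ε * ∑ x, z x ^ 2 := by
    intro z
    simp only [hM, add_mul, Finset.sum_add_distrib, Finset.mul_sum]
    congr 1
    · simp only [Finset.sum_mul]
      rw [Finset.sum_comm]
      refine Finset.sum_congr rfl fun i _ => ?_
      rw [sq, Finset.sum_mul_sum]
      refine Finset.sum_congr rfl fun x _ => Finset.sum_congr rfl fun y _ => by ring
    · exact Finset.sum_congr rfl fun x _ => by ring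
  have hinj : Function.Injective M := by
    rw [injective_iff_map_eq_zero]
    intro z hz
    have h1 := hquad z
    simp only [hz, Pi.zero_apply, zero_mul, Finset.sum_const_zero] at h1
    have h2 : 0 ≤ ∑ i, (∑ x, N x i * z x) ^ 2 := Finset.sum_nonneg fun _ _ => sq_nonneg _
    have h3 : 0 ≤ ∑ x, z x ^ 2 := Finset.sum_nonneg fun _ _ => sq_nonneg _
    have h4 : ∑ x, z x ^ 2 = 0 := by nlinarith
    rw [Finset.sum_eq_zero_iff_of_nonneg fun _ _ => sq_nonneg _] at h4
    funext x
    simpa using h4 x (Finset.mem_univ x)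
  obtain ⟨z, hz⟩ := LinearMap.injective_iff_surjective.1 hinj b
  have h1 := hquad z
  have h2 := hform z
  rw [hz] at h1
  refine ⟨fun i => ∑ x, N x i * z x, ?_⟩
  have h3 : ∀ x, b x - ∑ i, N x i * ∑ y, N y i * z y = ε * z x := by
    intro x
    have := hM z x
    rw [hz] at this
    linarith
  simp only [h3, mul_pow, ← Finset.mul_sum]
  have h4 : c * (ε ^ 2 * ∑ x, z x ^ 2) = ε * ∑ x, z x ^ 2 := by
    linear_combination (ε * ∑ x, z x ^ 2) * hc
  linarith

section Extension

variable {V : Type*} {G : SimpleGraph V} {n : ℕ} {W T : Finset V} {φ : V → Fin n → ℤ}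

/-- `φ` represents `A + 2` on the vertex set `W` as a Gram matrix of vectors `±e_i ± e_j`; the vectors
indexed by `T` are of the form `±(e_i - e_j)` and form a spanning tree of the coordinates. -/
structure IsRep (G : SimpleGraph V) (W T : Finset V) (φ : V → Fin n → ℤ) : Prop where
  norm : ∀ x ∈ W, ∑ i, φ x i ^ 2 = 2
  inner : ∀ x ∈ W, ∀ y ∈ W, x ≠ y → ∑ i, φ x i * φ y i = if G.Adj x y then 1 else 0
  sub : T ⊆ W
  balanced : ∀ x ∈ T, ∑ i, φ x i = 0
  cross : Crossing T φ
  solve : ∀ b : V → ℤ, ∃ f : Fin n → ℤ, ∀ x ∈ T, ∑ i, φ x i * f i = b x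

lemma isRep_update (h : IsRep G W T φ) {v : V} (hv : v ∉ W) {f : Fin n → ℤ}
    (hf2 : ∑ i, f i ^ 2 = 2)
    (hf : ∀ x ∈ W, ∑ i, φ x i * f i = if G.Adj x v then 1 else 0) :
    IsRep G (insert v W) T (Function.update φ v f) := by
  have hW : ∀ x ∈ W, Function.update φ v f x = φ x := fun x hx =>
    Function.update_of_ne (ne_of_mem_of_not_mem hx hv) _ _
  have hv' : Function.update φ v f v = f := Function.update_self _ _ _
  have hT := h.sub
  refine ⟨?_, ?_, hT.trans (Finset.subset_insert _ _), ?_, ?_, ?_⟩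
  · intro x hx
    rcases Finset.mem_insert.1 hx with rfl | hx
    · rwa [hv']
    · rw [hW x hx]
      exact h.norm x hx
  · intro x hx' y hy' hxy
    rcases Finset.mem_insert.1 hx' with rfl | hx <;> rcases Finset.mem_insert.1 hy' with rfl | hy
    · exact absurd rfl hxy
    · rw [hv', hW y hy]
      simp only [G.adj_comm x y, ← hf y hy, mul_comm]
    · rw [hv', hW x hx, hf x hx]
    · rw [hW x hx, hW y hy]
      exact h.inner x hx y hy hxy
  · intro x hx
    rw [hW x (hT hx)]
    exact h.balanced x hx
  · intro S hS hS'
    obtain ⟨x, hx, i, hi, j, hj, h1⟩ := h.cross S hS hS'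
    exact ⟨x, hx, i, hi, j, hj, by rwa [hW x (hT hx)]⟩
  · intro b
    obtain ⟨g, hg⟩ := h.solve b
    refine ⟨g, fun x hx => ?_⟩
    rw [hW x (hT hx)]
    exact hg x hx

lemma isRep_snoc (h : IsRep G W T φ) {v : V} (hv : v ∉ W) {f : Fin n → ℤ}
    (hf1 : ∑ i, f i ^ 2 = 1) (hs : (∑ i, f i) ^ 2 = 1)
    (hf : ∀ x ∈ W, ∑ i, φ x i * f i = if G.Adj x v then 1 else 0) :
    IsRep G (insert v W) (insert v T)
      (fun x => if x = v then (Fin.snoc f (-∑ i, f i) : Fin (n + 1) → ℤ) else Fin.snoc (φ x) 0) := by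
  set ψ : V → Fin (n + 1) → ℤ :=
    fun x => if x = v then Fin.snoc f (-∑ i, f i) else Fin.snoc (φ x) 0 with hψ
  have hW : ∀ x ∈ W, ψ x = Fin.snoc (φ x) 0 := fun x hx => if_neg (ne_of_mem_of_not_mem hx hv)
  have hv' : ψ v = Fin.snoc f (-∑ i, f i) := if_pos rfl
  have hT := h.sub
  refine ⟨?_, ?_, Finset.insert_subset_insert _ hT, ?_, ?_, ?_⟩
  · intro x hx
    rcases Finset.mem_insert.1 hx with rfl | hx
    · simp [hv', Fin.sum_univ_castSucc, hf1, hs]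
    · simp [hW x hx, Fin.sum_univ_castSucc, h.norm x hx]
  · intro x hx' y hy' hxy
    rcases Finset.mem_insert.1 hx' with rfl | hx <;> rcases Finset.mem_insert.1 hy' with rfl | hy
    · exact absurd rfl hxy
    · simp [hv', hW y hy, Fin.sum_univ_castSucc, G.adj_comm x y, ← hf y hy, mul_comm]
    · simp [hv', hW x hx, Fin.sum_univ_castSucc, hf x hx]
    · simp [hW x hx, hW y hy, Fin.sum_univ_castSucc, h.inner x hx y hy hxy]
  · intro x hx
    rcases Finset.mem_insert.1 hx with rfl | hx
    · simp [hv', Fin.sum_univ_castSucc]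
    · simp [hW x (hT hx), Fin.sum_univ_castSucc, h.balanced x hx]
  · intro S hS hS'
    have hs0 : ∑ i, f i ≠ 0 := fun h0 => by simp [h0] at hs
    obtain ⟨i, -, hi⟩ := Finset.exists_ne_zero_of_sum_ne_zero hs0
    have hvl : ψ v (Fin.last n) ≠ 0 := by simpa [hv'] using hs0
    have hvi : ψ v i.castSucc ≠ 0 := by simpa [hv'] using hi
    by_cases h0 : (Finset.univ.filter fun j : Fin n => j.castSucc ∈ S).Nonempty
    · by_cases h1 : (Finset.univ.filter fun j : Fin n => j.castSucc ∈ S) = Finset.univ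
      · have hall : ∀ j : Fin n, j.castSucc ∈ S := by
          simpa [Finset.filter_eq_self] using h1
        refine ⟨v, Finset.mem_insert_self _ _, i.castSucc, hall i, Fin.last n, fun hl => hS' ?_,
          hvi, hvl⟩
        ext j
        induction j using Fin.lastCases with
        | last => simpa using hl
        | cast j => simpa using hall j
      · obtain ⟨x, hx, a, ha, b, hb, hab⟩ := h.cross _ h0 h1
        refine ⟨x, Finset.mem_insert_of_mem hx, a.castSucc, by simpa using ha, b.castSucc,
          by simpa using hb, ?_⟩
        simpa [hW x (hT hx)] using hab
    · have hnone : ∀ j : Fin n, j.castSucc ∉ S := by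
        simpa [Finset.not_nonempty_iff_eq_empty, Finset.filter_eq_empty_iff] using h0
      obtain ⟨j, hj⟩ := hS
      refine ⟨v, Finset.mem_insert_self _ _, Fin.last n, ?_, i.castSucc, hnone i, hvl, hvi⟩
      induction j using Fin.lastCases with
      | last => exact hj
      | cast j => exact absurd hj (hnone j)
  · intro b
    obtain ⟨g, hg⟩ := h.solve b
    refine ⟨Fin.snoc g ((∑ i, f i) * (∑ i, f i * g i - b v)), fun x hx => ?_⟩
    rcases Finset.mem_insert.1 hx with rfl | hx
    · simp only [hv', Fin.sum_univ_castSucc, Fin.snoc_castSucc, Fin.snoc_last]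
      linear_combination (-(∑ i, f i * g i - b x)) * hs
    · simp [hW x (hT hx), Fin.sum_univ_castSucc, hg x hx]

lemma IsRep.insert_vertex (h : IsRep G W T φ) {v : V} (hv : v ∉ W) (hadj : ∃ x ∈ W, G.Adj x v)
    {f : Fin n → ℤ} (h1 : ∀ i, |f i| ≤ 1) (h2 : (Finset.univ.filter fun i => f i ≠ 0).card ≤ 2)
    (hf : ∀ x ∈ W, ∑ i, φ x i * f i = if G.Adj x v then 1 else 0) :
    ∃ n', n ≤ n' ∧ ∃ (T' : Finset V) (φ' : V → Fin n' → ℤ), IsRep G (insert v W) T' φ' := by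
  set S := Finset.univ.filter fun i => f i ≠ 0 with hS
  have hsq : ∀ i, f i ^ 2 = if f i ≠ 0 then 1 else 0 := fun i => by
    have := abs_le.1 (h1 i)
    split_ifs with h0
    · rcases (show f i = 1 ∨ f i = -1 by omega) with h3 | h3 <;> simp [h3]
    · simp [not_not.1 h0]
  have hcard : ∑ i, f i ^ 2 = S.card := by
    simp only [hsq, Finset.sum_boole, hS]
  have hne : S.card ≠ 0 := by
    intro h0
    obtain ⟨x, hx, hxv⟩ := hadj
    have := hf x hx
    rw [Finset.card_eq_zero, hS, Finset.filter_eq_empty_iff] at h0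
    simp only [Finset.mem_univ, true_implies, not_not] at h0
    simp [h0, hxv] at this
  rcases (show S.card = 1 ∨ S.card = 2 by omega) with h3 | h3
  · refine ⟨n + 1, n.le_succ, _, _, isRep_snoc h hv (by simp [hcard, h3]) ?_ hf⟩
    obtain ⟨i, hi⟩ := Finset.card_eq_one.1 h3
    have hz : ∀ j, j ≠ i → f j = 0 := fun j hj => by
      by_contra h0
      have : j ∈ S := by simp [hS, h0]
      rw [hi, Finset.mem_singleton] at this
      exact hj this
    rw [Finset.sum_eq_single i (fun j _ hj => hz j hj) (by simp), hsq i, if_pos]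
    have : i ∈ S := by simp [hi]
    simpa [hS] using this
  · exact ⟨n, le_rfl, _, _, isRep_update h hv (by simp [hcard, h3]) hf⟩

variable [Fintype V]

lemma IsRep.quad_eq (h : IsRep G W T φ) {z : V → ℝ} (hz : ∀ x ∉ W, z x = 0) :
    ∑ i, (∑ x, (φ x i : ℝ) * z x) ^ 2
      = ∑ x, ∑ y, (if G.Adj x y then 1 else 0) * (z x * z y) + 2 * ∑ x, z x ^ 2 := by
  have h1 : ∀ i, (∑ x, (φ x i : ℝ) * z x) ^ 2
      = ∑ x, ∑ y, ((φ x i * φ y i : ℤ) : ℝ) * (z x * z y) := fun i => by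
    rw [sq, Finset.sum_mul_sum]
    refine Finset.sum_congr rfl fun x _ => Finset.sum_congr rfl fun y _ => by push_cast; ring
  simp only [h1]
  rw [Finset.sum_comm, Finset.mul_sum, ← Finset.sum_add_distrib]
  refine Finset.sum_congr rfl fun x _ => ?_
  rw [Finset.sum_comm]
  simp only [← Finset.sum_mul, ← Int.cast_sum]
  by_cases hx : x ∈ W
  swap
  · simp [hz x hx]
  have h2 : ∀ y, ((∑ i, φ x i * φ y i : ℤ) : ℝ) * (z x * z y)
      = (if G.Adj x y then 1 else 0) * (z x * z y) + if y = x then 2 * z x ^ 2 else 0 := by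
    intro y
    by_cases hy : y ∈ W
    · by_cases hxy : y = x
      · subst hxy
        have := h.norm y hy
        simp only [← sq, this]
        simp
      · rw [h.inner x hx y hy (Ne.symm hxy), if_neg hxy]
        simp
    · have : y ≠ x := fun e => hy (e ▸ hx)
      simp [hz y hy, this]
  simp only [h2, Finset.sum_add_distrib, Finset.sum_ite_eq', Finset.mem_univ, if_true]

lemma IsRep.exists_insert {t ε c κ : ℝ} {K : ℕ} (P : Params t ε c κ) (hK5 : 5 ≤ K)
    (hK : IsLarge t κ K) (hn : 2 * K ≤ n)
    (hform : ∀ z : V → ℝ, 0 ≤ ∑ x, ∑ y, (if G.Adj x y then 1 else 0) * (z x * z y)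
      + (t + t⁻¹) * ∑ x, z x ^ 2)
    (h : IsRep G W T φ) {v : V} (hv : v ∉ W) (hadj : ∃ x ∈ W, G.Adj x v) :
    ∃ n', n ≤ n' ∧ ∃ (T' : Finset V) (φ' : V → Fin n' → ℤ), IsRep G (insert v W) T' φ' := by
  obtain ⟨u, hu⟩ := exists_energy_minimizer (V := V) (ι := Fin n)
    (fun x i => if x ∈ W then (φ x i : ℝ) else 0)
    (fun x => if x ∈ W then (if G.Adj x v then 1 else 0) else 0) (c := c) (L := t + t⁻¹)
    P.eps_pos P.c_mul_eps (fun z => by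
      set w : V → ℝ := fun x => if x ∈ W then z x else 0 with hw
      have hw0 : ∀ x ∉ W, w x = 0 := fun x hx => if_neg hx
      have h1 := hform fun x => w x - if x = v then 1 else 0
      have h2 := h.quad_eq hw0
      have h3 : ∑ x, ∑ y, (if G.Adj x y then (1 : ℝ) else 0)
          * ((w x - if x = v then 1 else 0) * (w y - if y = v then 1 else 0))
          = ∑ x, ∑ y, (if G.Adj x y then 1 else 0) * (w x * w y)
            - 2 * ∑ x, (if G.Adj x v then 1 else 0) * w x := by
        have e : ∀ x y, (if G.Adj x y then (1 : ℝ) else 0)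
            * ((w x - if x = v then 1 else 0) * (w y - if y = v then 1 else 0))
            = (if G.Adj x y then 1 else 0) * (w x * w y)
              - (if y = v then (if G.Adj x v then 1 else 0) * w x else 0)
              - (if x = v then (if G.Adj y v then 1 else 0) * w y else 0) := by
          intro x y
          by_cases hx : x = v <;> by_cases hy : y = v
          · subst hx
            subst hy
            simp
          · subst hx
            simp only [hy, G.adj_comm y x, if_true, if_false]
            ring
          · subst hy
            simp only [hx, if_true, if_false]
            ring
          · simp only [hx, hy, if_false]
            ring
        simp only [e, Finset.sum_sub_distrib, Finset.sum_ite_eq', Finset.mem_univ, if_true]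
        rw [Finset.sum_comm (f := fun x y => if x = v then _ else _)]
        simp only [Finset.sum_ite_eq', Finset.mem_univ, if_true]
        ring
      have h4 : ∑ x, (w x - if x = v then 1 else 0) ^ 2 = ∑ x, w x ^ 2 + 1 := by
        have e : ∀ x, (w x - if x = v then 1 else 0) ^ 2 = w x ^ 2 + if x = v then 1 else 0 := by
          intro x
          by_cases hx : x = v
          · subst hx
            simp [hw0 x hv]
          · simp [hx]
        simp only [e, Finset.sum_add_distrib, Finset.sum_ite_eq', Finset.mem_univ, if_true]
      have h5 : ∀ i, ∑ x, (if x ∈ W then (φ x i : ℝ) else 0) * z x = ∑ x, (φ x i : ℝ) * w x :=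
        fun i => Finset.sum_congr rfl fun x _ => by by_cases hx : x ∈ W <;> simp [hw, hx]
      have h6 : ∑ x, (if x ∈ W then (if G.Adj x v then (1 : ℝ) else 0) else 0) * z x
          = ∑ x, (if G.Adj x v then 1 else 0) * w x :=
        Finset.sum_congr rfl fun x _ => by by_cases hx : x ∈ W <;> simp [hw, hx]
      have h7 : ∑ x, w x ^ 2 ≤ ∑ x, z x ^ 2 :=
        Finset.sum_le_sum fun x _ => by by_cases hx : x ∈ W <;> simp [hw, hx, sq_nonneg]
      have h8 := mul_le_mul_of_nonneg_left h7 P.eps_pos.le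
      rw [h3, h4] at h1
      simp only [h5, h6, h2]
      rw [P.eps] at h8 ⊢
      linarith)
  have hb : ∑ i, u i ^ 2 + c * ∑ x ∈ W,
      (((if G.Adj x v then 1 else 0 : ℤ) : ℝ) - ∑ i, (φ x i : ℝ) * u i) ^ 2 ≤ t + t⁻¹ := by
    refine le_trans (add_le_add le_rfl (mul_le_mul_of_nonneg_left ?_ P.c_pos.le)) hu
    refine le_trans (Finset.sum_le_sum fun x hx => ?_) (Finset.sum_le_sum_of_subset_of_nonneg
      (Finset.subset_univ W) fun _ _ _ => sq_nonneg _)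
    simp [hx]
  obtain ⟨f, h1, h2, hf⟩ := exists_integral_solution P hK5 hK hn h.sub h.norm h.cross h.balanced
    (b := fun x => if G.Adj x v then 1 else 0) hb (h.solve _)
  exact h.insert_vertex hv hadj h1 h2 hf

end Extension

section Base

variable {V : Type*} {G : SimpleGraph V}

/-- A family of vertices whose vectors `±(e_{a k} - e_{k + 1})`, `a k ≤ k`, have the right inner
products spans a represented set. -/
lemma exists_isRep_of_tree {m : ℕ} {p : Fin m → V} (hp : Function.Injective p) {s : Fin m → ℤ}
    (hs : ∀ k, s k ^ 2 = 1) {a : Fin m → Fin (m + 1)} (ha : ∀ k, a k < k.succ)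
    (hinner : ∀ k l, k ≠ l → s k * s l * ((if a k = a l then 1 else 0)
      - (if a k = l.succ then 1 else 0) - (if a l = k.succ then 1 else 0))
        = if G.Adj (p k) (p l) then 1 else 0)
    (hsolve : ∀ b : Fin m → ℤ, ∃ f : Fin (m + 1) → ℤ,
      ∀ k, s k * (f (a k) - f k.succ) = b k) :
    ∃ (W : Finset V) (φ : V → Fin (m + 1) → ℤ), IsRep G W W φ := by
  set ψ : Fin m → Fin (m + 1) → ℤ := fun k =>
    s k • (Pi.single (a k) 1 - Pi.single k.succ 1) with hψ
  have hsum : ∀ k (f : Fin (m + 1) → ℤ), ∑ i, ψ k i * f i = s k * (f (a k) - f k.succ) := by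
    intro k f
    simp [hψ, Pi.single_apply, mul_assoc, sub_mul, ← Finset.mul_sum]
  have hφ : ∀ k, Function.extend p ψ 0 (p k) = ψ k := hp.extend_apply ψ 0
  have hmem : ∀ x ∈ Finset.univ.map ⟨p, hp⟩, ∃ k, p k = x := by simp
  refine ⟨Finset.univ.map ⟨p, hp⟩, Function.extend p ψ 0, ?_, ?_, subset_rfl, ?_, ?_, ?_⟩
  · intro x hx
    obtain ⟨k, rfl⟩ := hmem x hx
    rw [hφ]
    simp only [sq]
    rw [hsum]
    have h1 := (ha k).ne
    simp only [hψ, Pi.smul_apply, Pi.sub_apply, Pi.single_apply, if_true, h1, h1.symm, if_false,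
      smul_eq_mul]
    linear_combination 2 * hs k
  · intro x hx y hy hxy
    obtain ⟨k, rfl⟩ := hmem x hx
    obtain ⟨l, rfl⟩ := hmem y hy
    have hkl : k ≠ l := fun e => hxy (e ▸ rfl)
    rw [hφ, hφ, hsum, ← hinner k l hkl]
    simp only [hψ, Pi.smul_apply, Pi.sub_apply, Pi.single_apply, smul_eq_mul, Fin.succ_inj,
      hkl.symm, if_false, eq_comm (a := k.succ)]
    ring
  · intro x hx
    obtain ⟨k, rfl⟩ := hmem x hx
    simpa [hφ] using hsum k 1
  · intro S hS hS'
    by_contra! hno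
    have hiff : ∀ k, a k ∈ S ↔ k.succ ∈ S := by
      intro k
      have h0 : s k ≠ 0 := fun h0 => by simpa [h0] using hs k
      have h1 := (ha k).ne
      have h2 : ψ k (a k) ≠ 0 := by simp [hψ, h0, h1]
      have h3 : ψ k k.succ ≠ 0 := by simp [hψ, h0, h1.symm]
      have h4 := hno (p k) (by simp)
      rw [hφ] at h4
      constructor
      · intro h
        by_contra hc
        exact h3 (h4 _ h _ hc h2)
      · intro h
        by_contra hc
        exact h2 (h4 _ h _ hc h3)
    have hall : ∀ (j : ℕ) (hj : j < m + 1), (⟨j, hj⟩ : Fin (m + 1)) ∈ S ↔ (0 : Fin (m + 1)) ∈ S := by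
      intro j
      induction j using Nat.strong_induction_on with
      | _ j ih =>
        intro hj
        rcases j with _ | j
        · rfl
        · have h1 := hiff ⟨j, by omega⟩
          have h2 := ha ⟨j, by omega⟩
          rw [Fin.lt_def] at h2
          exact h1.symm.trans (ih _ h2 (a ⟨j, by omega⟩).isLt)
    obtain ⟨i, hi⟩ := hS
    refine hS' (Finset.eq_univ_of_forall fun j => ?_)
    exact (hall j j.isLt).2 ((hall i i.isLt).1 hi)
  · intro b
    obtain ⟨f, hf⟩ := hsolve fun k => b (p k)
    refine ⟨f, fun x hx => ?_⟩
    obtain ⟨k, rfl⟩ := hmem x hx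
    rw [hφ, hsum, hf]

lemma exists_isRep_of_path {m : ℕ} {p : Fin m → V} (hp : Function.Injective p)
    (hadj : ∀ k l : Fin m, G.Adj (p k) (p l) ↔ (k : ℕ) + 1 = l ∨ (l : ℕ) + 1 = k) :
    ∃ (W : Finset V) (φ : V → Fin (m + 1) → ℤ), IsRep G W W φ := by
  have hsq : ∀ k : ℕ, ((-1 : ℤ) ^ k) ^ 2 = 1 := fun k => by
    rw [← pow_mul, mul_comm, pow_mul, neg_one_sq, one_pow]
  refine exists_isRep_of_tree hp (s := fun k => (-1) ^ (k : ℕ)) (a := Fin.castSucc)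
    (fun k => hsq k) (fun k => Fin.castSucc_lt_succ) (fun k l hkl => ?_) fun b => ?_
  · have h0 : (k : ℕ) ≠ l := fun h => hkl (Fin.ext h)
    simp only [hadj, Fin.ext_iff, Fin.val_castSucc, Fin.val_succ, h0, if_false]
    by_cases h1 : (k : ℕ) = l + 1
    · have h2 : (l : ℕ) ≠ l + 1 + 1 := by omega
      simp only [h1, h2, if_true, if_false, or_true]
      rw [pow_succ]
      linear_combination hsq l
    · by_cases h2 : (l : ℕ) = k + 1
      · have h3 : (k : ℕ) ≠ k + 1 + 1 := by omega
        simp only [h2, h3, if_true, if_false, true_or]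
        rw [pow_succ]
        linear_combination hsq k
      · simp [h1, h2, Ne.symm h1, Ne.symm h2]
  · refine ⟨fun j => -∑ i ∈ Finset.range j, if h : i < m then (-1) ^ i * b ⟨i, h⟩ else 0,
      fun k => ?_⟩
    simp only [Fin.val_castSucc, Fin.val_succ, Finset.sum_range_succ, k.isLt, dif_pos]
    linear_combination b k * hsq k

lemma exists_isRep_of_clique {m : ℕ} {p : Fin m → V} (hp : Function.Injective p)
    (hadj : ∀ k l : Fin m, k ≠ l → G.Adj (p k) (p l)) :
    ∃ (W : Finset V) (φ : V → Fin (m + 1) → ℤ), IsRep G W W φ := by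
  refine exists_isRep_of_tree hp (s := fun _ => 1) (a := fun _ => 0)
    (fun k => one_pow 2) (fun k => Fin.succ_pos k) (fun k l hkl => ?_) fun b => ?_
  · simp [hadj k l hkl, (Fin.succ_ne_zero _).symm]
  · exact ⟨Fin.cons 0 fun k => -b k, fun k => by simp⟩

end Base

section Size

lemma ramsey (r : ℕ) : ∀ s : ℕ, ∃ N : ℕ, ∀ (V : Type) (G : SimpleGraph V) (S : Finset V),
    N ≤ S.card → (∃ C ⊆ S, C.card = r ∧ ∀ x ∈ C, ∀ y ∈ C, x ≠ y → G.Adj x y) ∨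
      ∃ I ⊆ S, I.card = s ∧ ∀ x ∈ I, ∀ y ∈ I, ¬ G.Adj x y := by
  induction r with
  | zero => exact fun s => ⟨0, fun V G S _ => Or.inl ⟨∅, by simp⟩⟩
  | succ r ihr =>
    intro s
    induction s with
    | zero => exact ⟨0, fun V G S _ => Or.inr ⟨∅, by simp⟩⟩
    | succ s ihs =>
      obtain ⟨N₁, h₁⟩ := ihr (s + 1)
      obtain ⟨N₂, h₂⟩ := ihs
      refine ⟨N₁ + N₂ + 1, fun V G S hS => ?_⟩
      obtain ⟨v, hv⟩ : S.Nonempty := Finset.card_pos.1 (by omega)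
      have hcard := Finset.card_filter_add_card_filter_not (s := S.erase v) (fun x => G.Adj v x)
      rw [Finset.card_erase_of_mem hv] at hcard
      have hsub : ∀ (p : V → Prop) (C : Finset V), (∀ x ∈ C, x ∈ S.erase v ∧ p x) →
          insert v C ⊆ S ∧ v ∉ C ∧ ∀ x ∈ C, p x := fun p C hC =>
        ⟨Finset.insert_subset hv fun x hx => Finset.mem_of_mem_erase (hC x hx).1,
          fun h => Finset.ne_of_mem_erase (hC v h).1 rfl, fun x hx => (hC x hx).2⟩
      by_cases hN : N₁ ≤ ({x ∈ S.erase v | G.Adj v x}).card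
      · rcases h₁ V G _ hN with ⟨C, hC, hr, hadj⟩ | ⟨I, hI, h⟩
        · obtain ⟨h3, h4, h5⟩ := hsub _ C fun x hx => Finset.mem_filter.1 (hC hx)
          refine Or.inl ⟨insert v C, h3, by rw [Finset.card_insert_of_notMem h4, hr], ?_⟩
          intro x hx' y hy' hxy
          rcases Finset.mem_insert.1 hx' with rfl | hx <;>
            rcases Finset.mem_insert.1 hy' with rfl | hy
          · exact absurd rfl hxy
          · exact h5 y hy
          · exact (h5 x hx).symm
          · exact hadj x hx y hy hxy
        · exact Or.inr ⟨I, fun x hx => Finset.mem_of_mem_erase (Finset.mem_filter.1 (hI hx)).1, h⟩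
      · rcases h₂ V G {x ∈ S.erase v | ¬ G.Adj v x} (by omega) with ⟨C, hC, h⟩ | ⟨I, hI, hr, hadj⟩
        · exact Or.inl ⟨C, fun x hx => Finset.mem_of_mem_erase (Finset.mem_filter.1 (hC hx)).1, h⟩
        · obtain ⟨h3, h4, h5⟩ := hsub _ I fun x hx => Finset.mem_filter.1 (hI hx)
          refine Or.inr ⟨insert v I, h3, by rw [Finset.card_insert_of_notMem h4, hr], ?_⟩
          intro x hx' y hy'
          rcases Finset.mem_insert.1 hx' with rfl | hx <;>
            rcases Finset.mem_insert.1 hy' with rfl | hy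
          · exact G.loopless.irrefl _
          · exact h5 y hy
          · exact fun h => h5 x hx h.symm
          · exact hadj x hx y hy

variable {V : Type*} {G : SimpleGraph V}

lemma exists_adj_dist_eq (hG : G.Connected) {v w : V} {k : ℕ} (h : G.dist v w = k + 1) :
    ∃ x, G.Adj x w ∧ G.dist v x = k := by
  obtain ⟨p, hp⟩ := hG.exists_walk_length_eq_dist v w
  have h1 := p.adj_getVert_succ (i := k) (by omega)
  have h2 : p.getVert (k + 1) = w := p.getVert_of_length_le (by omega)
  rw [h2] at h1
  refine ⟨_, h1, le_antisymm ?_ ?_⟩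
  · refine (SimpleGraph.dist_le (p.take k)).trans ?_
    rw [SimpleGraph.Walk.take_length]
    exact min_le_left _ _
  · have h3 := hG.dist_triangle (u := v) (v := p.getVert k) (w := w)
    rw [SimpleGraph.dist_eq_one_iff_adj.2 h1] at h3
    omega

lemma exists_isRep_of_le_dist (hG : G.Connected) {v w : V} {m : ℕ} (h : m ≤ G.dist v w) :
    ∃ (W : Finset V) (φ : V → Fin (m + 1) → ℤ), IsRep G W W φ := by
  obtain ⟨p, hp⟩ := hG.exists_walk_length_eq_dist v w
  have hdist : ∀ k ≤ m, G.dist v (p.getVert k) = k := by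
    intro k hk
    have h1 := SimpleGraph.dist_le (p.take k)
    have h2 := SimpleGraph.dist_le (p.drop k)
    have h3 := hG.dist_triangle (u := v) (v := p.getVert k) (w := w)
    rw [SimpleGraph.Walk.take_length] at h1
    rw [SimpleGraph.Walk.drop_length] at h2
    omega
  have hstep : ∀ {k l : ℕ}, k ≤ m → l ≤ m → G.Adj (p.getVert k) (p.getVert l) → l ≤ k + 1 := by
    intro k l hk hl hadj
    have h1 := hG.dist_triangle (u := v) (v := p.getVert k) (w := p.getVert l)
    rwa [hdist k hk, hdist l hl, SimpleGraph.dist_eq_one_iff_adj.2 hadj] at h1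
  refine exists_isRep_of_path (p := fun k : Fin m => p.getVert k) (fun k l hkl => ?_)
    fun k l => ⟨fun hadj => ?_, ?_⟩
  · have h1 := hdist k k.isLt.le
    rw [show p.getVert k = p.getVert l from hkl, hdist l l.isLt.le] at h1
    exact Fin.ext h1.symm
  · have h1 := hstep k.isLt.le l.isLt.le hadj
    have h2 := hstep l.isLt.le k.isLt.le hadj.symm
    have h3 : (k : ℕ) ≠ l := fun h => G.loopless.irrefl (p.getVert l) (by
      rwa [show p.getVert (k : ℕ) = p.getVert l by rw [h]] at hadj)
    omega
  · rintro (h1 | h1)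
    · rw [← h1]
      exact p.adj_getVert_succ (by omega)
    · rw [← h1]
      exact (p.adj_getVert_succ (by omega)).symm

variable [Fintype V]

/-- A graph with an induced star `K_{1,5}` has smallest eigenvalue less than `-2.1`. -/
lemma not_star_five {lam : ℝ} (hlam : lam < 2.1)
    (hform : ∀ z : V → ℝ,
      0 ≤ ∑ x, ∑ y, (if G.Adj x y then 1 else 0) * (z x * z y) + lam * ∑ x, z x ^ 2)
    {v : V} {I : Finset V} (hI : I.card = 5) (hv : ∀ x ∈ I, G.Adj v x)
    (hind : ∀ x ∈ I, ∀ y ∈ I, ¬ G.Adj x y) : False := by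
  have hvI : v ∉ I := fun h => G.loopless.irrefl _ (hv v h)
  set z : V → ℝ := fun x => (if x ∈ I then 1 else 0) - 2 * if x = v then 1 else 0 with hz
  have hsum : ∀ F : V → ℝ, ∑ x, z x * F x = ∑ x ∈ I, F x - 2 * F v := by
    intro F
    simp [hz, sub_mul, Finset.sum_sub_distrib, ite_mul]
  have h := hform z
  have h1 : ∑ x, ∑ y, (if G.Adj x y then (1 : ℝ) else 0) * (z x * z y) = -20 := by
    have h2 : ∀ x, ∑ y, (if G.Adj x y then (1 : ℝ) else 0) * (z x * z y)
        = z x * (∑ y ∈ I, (if G.Adj x y then (1 : ℝ) else 0)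
          - 2 * if G.Adj x v then 1 else 0) := by
      intro x
      rw [← hsum, Finset.mul_sum]
      exact Finset.sum_congr rfl fun y _ => by ring
    rw [Finset.sum_congr rfl fun x _ => h2 x, hsum]
    have h3 : ∀ x ∈ I, ∑ y ∈ I, (if G.Adj x y then (1 : ℝ) else 0)
        - 2 * (if G.Adj x v then 1 else 0) = -2 := by
      intro x hx
      rw [Finset.sum_eq_zero fun y hy => if_neg (hind x hx y hy), if_pos (hv x hx).symm]
      norm_num
    rw [Finset.sum_congr rfl h3, Finset.sum_congr rfl fun y hy => if_pos (hv y hy),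
      if_neg (G.loopless.irrefl v)]
    simp [hI]
    norm_num
  have h4 : ∑ x, z x ^ 2 = 9 := by
    simp only [sq]
    rw [hsum, Finset.sum_congr rfl fun x hx => show z x = 1 by
      simp [hz, hx, ne_of_mem_of_not_mem hx hvI]]
    simp [hz, hI, hvI]
    norm_num
  rw [h1, h4] at h
  linarith

lemma card_ball_le (hG : G.Connected) {D : ℕ}
    (hD : ∀ x, ({y | G.Adj x y} : Finset V).card ≤ D) (v : V) (k : ℕ) :
    ({w | G.dist v w ≤ k} : Finset V).card ≤ (D + 1) ^ k := by
  induction k with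
  | zero =>
    have h : ({w | G.dist v w ≤ 0} : Finset V) = {v} := by
      ext w
      simp [hG.dist_eq_zero_iff, eq_comm]
    rw [h, Finset.card_singleton, pow_zero]
  | succ k ih =>
    have hsub : ({w | G.dist v w ≤ k + 1} : Finset V) ⊆
        ({w | G.dist v w ≤ k} : Finset V).biUnion fun x => insert x ({y | G.Adj x y} : Finset V) := by
      intro w hw
      have hw : G.dist v w ≤ k + 1 := (Finset.mem_filter.1 hw).2
      rw [Finset.mem_biUnion]
      rcases Nat.le_succ_iff.1 hw with h | h
      · exact ⟨w, by simpa using h, Finset.mem_insert_self _ _⟩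
      · obtain ⟨x, hx, hd⟩ := exists_adj_dist_eq hG h
        exact ⟨x, by simp [hd], Finset.mem_insert_of_mem (by simpa using hx)⟩
    refine (Finset.card_le_card hsub).trans ((Finset.card_biUnion_le_card_mul _ _ (D + 1) ?_).trans ?_)
    · exact fun x _ => (Finset.card_insert_le _ _).trans (Nat.succ_le_succ (hD x))
    · rw [pow_succ]
      exact Nat.mul_le_mul_right _ ih

/-- Large connected graphs with smallest eigenvalue greater than `-2.1` contain a long induced path
or a large clique. -/
lemma exists_isRep_of_card_lt (m : ℕ) : ∃ N : ℕ, ∀ (V : Type) [Fintype V] (G : SimpleGraph V)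
    (lam : ℝ), lam < 2.1 → G.Connected →
    (∀ z : V → ℝ,
      0 ≤ ∑ x, ∑ y, (if G.Adj x y then 1 else 0) * (z x * z y) + lam * ∑ x, z x ^ 2) →
    N < Fintype.card V → ∃ (W : Finset V) (φ : V → Fin (m + 1) → ℤ), IsRep G W W φ := by
  obtain ⟨D, hD⟩ := ramsey m 5
  refine ⟨(D + 1) ^ m, fun V _ G lam hlam hG hform hN => ?_⟩
  by_cases hdeg : ∀ x, ({y | G.Adj x y} : Finset V).card ≤ D
  · obtain ⟨v⟩ := hG.nonempty
    have h1 := card_ball_le hG hdeg v m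
    by_cases h2 : ∀ w, G.dist v w ≤ m
    · rw [Finset.filter_true_of_mem fun w _ => h2 w, Finset.card_univ] at h1
      omega
    · push Not at h2
      obtain ⟨w, hw⟩ := h2
      exact exists_isRep_of_le_dist hG hw.le
  · push Not at hdeg
    obtain ⟨v, hv⟩ := hdeg
    rcases hD V G _ hv.le with ⟨C, -, hC, hadj⟩ | ⟨I, hI, h5, hind⟩
    · refine exists_isRep_of_clique (p := fun k => (C.equivFinOfCardEq hC).symm k)
        (Subtype.val_injective.comp (Equiv.injective _)) fun k l hkl => ?_
      refine hadj _ (Subtype.prop _) _ (Subtype.prop _) fun h => hkl ?_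
      exact (Equiv.injective _) (Subtype.ext h)
    · exact (not_star_five hlam hform h5 (fun x hx => by simpa using hI hx) hind).elim

end Size

section Propagation

variable {V : Type*} [Fintype V] {G : SimpleGraph V}

lemma IsRep.exists_univ {t ε c κ : ℝ} (P : Params t ε c κ) {K : ℕ} (hK5 : 5 ≤ K)
    (hK : IsLarge t κ K) (hG : G.Connected)
    (hform : ∀ z : V → ℝ,
      0 ≤ ∑ x, ∑ y, (if G.Adj x y then 1 else 0) * (z x * z y) + (t + t⁻¹) * ∑ x, z x ^ 2) :
    ∀ (d : ℕ) {n : ℕ}, 2 * K ≤ n → ∀ {W T : Finset V} {φ : V → Fin n → ℤ}, IsRep G W T φ →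
      (Wᶜ).card = d → ∃ n' : ℕ, ∃ (T' : Finset V) (φ' : V → Fin n' → ℤ),
        IsRep G Finset.univ T' φ' := by
  intro d
  induction d with
  | zero =>
    intro n _ W T φ h hd
    rw [Finset.card_eq_zero, Finset.compl_eq_empty_iff] at hd
    subst hd
    exact ⟨n, T, φ, h⟩
  | succ d ih =>
    intro n hn W T φ h hd
    obtain ⟨v, hv⟩ : (Wᶜ).Nonempty := Finset.card_pos.1 (by omega)
    have hW : W.Nonempty := by
      obtain ⟨x, hx, -⟩ := h.cross {⟨0, by omega⟩} (Finset.singleton_nonempty _) fun hS => by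
        have := congrArg Finset.card hS
        rw [Finset.card_singleton, Finset.card_univ, Fintype.card_fin] at this
        omega
      exact ⟨x, h.sub hx⟩
    obtain ⟨u, hu⟩ := hW
    obtain ⟨p⟩ := hG.preconnected u v
    obtain ⟨e, -, he, he'⟩ := p.exists_boundary_dart (W : Set V) hu (by simpa using hv)
    have he' : e.snd ∉ W := by simpa using he'
    obtain ⟨n', hn', T', φ', h'⟩ := h.exists_insert P hK5 hK hn hform he' ⟨e.fst, he, e.adj⟩
    refine ih (hn.trans hn') h' ?_
    rw [Finset.compl_insert, Finset.card_erase_of_mem (Finset.mem_compl.2 he'), hd]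
    rfl

end Propagation

section Spectrum

variable {V : Type*} [Fintype V]

lemma isHermitian_adjMat (G : SimpleGraph V) : (adjMat G).IsHermitian := by
  ext x y
  simp [adjMat, G.adj_comm]

lemma dotProduct_adjMat_mulVec (G : SimpleGraph V) (z : V → ℝ) :
    z ⬝ᵥ (adjMat G).mulVec z = ∑ x, ∑ y, (if G.Adj x y then 1 else 0) * (z x * z y) := by
  simp only [dotProduct, Matrix.mulVec, adjMat, Finset.mul_sum]
  exact Finset.sum_congr rfl fun x _ => Finset.sum_congr rfl fun y _ => by ring

lemma minEig_le (A : Matrix V V ℝ) {μ : ℝ} (h : IsEigenvalue A μ) : minEig A ≤ μ := by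
  refine csInf_le (Set.Finite.bddBelow ?_) h
  refine (Module.End.finite_hasEigenvalue (Matrix.toLin' A)).subset fun ν hν => ?_
  obtain ⟨v, hv, hA⟩ := hν
  exact Module.End.hasEigenvalue_of_hasEigenvector
    (Module.End.hasEigenvector_iff.2 ⟨Module.End.mem_eigenspace_iff.2 (by simpa using hA), hv⟩)

lemma form_nonneg_of_le_minEig (G : SimpleGraph V) {lam : ℝ} (h : -lam ≤ minEig (adjMat G))
    (z : V → ℝ) :
    0 ≤ ∑ x, ∑ y, (if G.Adj x y then 1 else 0) * (z x * z y) + lam * ∑ x, z x ^ 2 := by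
  have hA : (adjMat G + lam • (1 : Matrix V V ℝ)).IsHermitian :=
    (isHermitian_adjMat G).add (by ext x y; simp [Matrix.one_apply, eq_comm])
  have hpsd : (adjMat G + lam • (1 : Matrix V V ℝ)).PosSemidef := by
    refine hA.posSemidef_iff_eigenvalues_nonneg.2 fun i => ?_
    have h1 := hA.mulVec_eigenvectorBasis i
    have h2 : IsEigenvalue (adjMat G) (hA.eigenvalues i - lam) := by
      refine ⟨hA.eigenvectorBasis i, fun h0 => ?_, ?_⟩
      · exact hA.eigenvectorBasis.orthonormal.ne_zero i (by ext x; exact congrFun h0 x)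
      · rw [Matrix.add_mulVec, Matrix.smul_mulVec, Matrix.one_mulVec] at h1
        rw [sub_smul, ← h1, add_sub_cancel_right]
    have h3 := minEig_le _ h2
    show 0 ≤ hA.eigenvalues i
    linarith
  have h1 := hpsd.dotProduct_mulVec_nonneg z
  rw [star_trivial, Matrix.add_mulVec, Matrix.smul_mulVec, Matrix.one_mulVec, dotProduct_add,
    dotProduct_smul, dotProduct_adjMat_mulVec, smul_eq_mul] at h1
  simpa only [dotProduct, ← sq] using h1

lemma le_minEig_of_form_nonneg (G : SimpleGraph V)
    (h : ∀ z : V → ℝ,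
      0 ≤ ∑ x, ∑ y, (if G.Adj x y then 1 else 0) * (z x * z y) + 2 * ∑ x, z x ^ 2) :
    -2 ≤ minEig (adjMat G) := by
  rcases Set.eq_empty_or_nonempty {μ : ℝ | IsEigenvalue (adjMat G) μ} with h0 | h0
  · rw [minEig, h0, Real.sInf_empty]
    norm_num
  · refine le_csInf h0 ?_
    rintro μ ⟨v, hv, hA⟩
    have h1 := h v
    rw [← dotProduct_adjMat_mulVec, hA, dotProduct_smul, smul_eq_mul] at h1
    obtain ⟨x, hx⟩ := Function.ne_iff.1 hv
    have h2 : 0 < ∑ x, v x ^ 2 :=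
      Finset.sum_pos' (fun _ _ => sq_nonneg _) ⟨x, Finset.mem_univ x, (sq_nonneg _).lt_of_ne' (pow_ne_zero 2 hx)⟩
    simp only [dotProduct, ← sq] at h1
    rw [← add_mul] at h1
    linarith [nonneg_of_mul_nonneg_left h1 h2]

end Spectrum

lemma exists_add_inv_eq {βs lamStar lam : ℝ} (hβs : βs ^ 3 = βs + 1)
    (hstar : lamStar = Real.sqrt βs + (Real.sqrt βs)⁻¹) (h2 : 2 < lam) (hlt : lam < lamStar) :
    ∃ t : ℝ, 1 < t ∧ t ^ 6 < t ^ 2 + 1 ∧ lam = t + t⁻¹ := by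
  have h1 : 0 < lam ^ 2 - 4 := by nlinarith
  set r := Real.sqrt (lam ^ 2 - 4) with hr
  have hr0 : 0 < r := Real.sqrt_pos.2 h1
  have hr2 : r ^ 2 = lam ^ 2 - 4 := Real.sq_sqrt h1.le
  have hβ : 1 < βs := by
    by_contra! hc
    nlinarith [sq_nonneg (βs + 1), sq_nonneg βs, sq_nonneg (βs - 1), sq_nonneg (2 * βs + 1)]
  set s := Real.sqrt βs with hs
  have hs1 : 1 < s := Real.lt_sqrt_of_sq_lt (by simpa using hβ)
  have hs2 : s ^ 2 = βs := Real.sq_sqrt (by linarith)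
  have ht : 1 < (lam + r) / 2 := by linarith
  have hinv : lam = (lam + r) / 2 + ((lam + r) / 2)⁻¹ := by
    have : lam + r ≠ 0 := by linarith
    field_simp
    linear_combination -hr2
  set t := (lam + r) / 2 with ht'
  have hts : t < s := by
    rw [hinv, hstar] at hlt
    by_contra! hc
    have h3 : s + s⁻¹ ≤ t + t⁻¹ := by
      have h4 : t + t⁻¹ - (s + s⁻¹) = (t - s) * (t * s - 1) / (t * s) := by
        have : t ≠ 0 := by linarith
        have : s ≠ 0 := by linarith
        field_simp
        ring
      have h5 : 0 ≤ (t - s) * (t * s - 1) / (t * s) := by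
        have : 1 ≤ t * s := by nlinarith
        exact div_nonneg (mul_nonneg (by linarith) (by linarith)) (by linarith)
      linarith
    linarith
  refine ⟨t, ht, ?_, hinv⟩
  have h3 : t ^ 2 < βs := by
    rw [← hs2]
    gcongr
  have h4 : 1 < t ^ 2 := by nlinarith
  have h5 : t ^ 6 = (t ^ 2) ^ 3 := by ring
  rw [h5]
  nlinarith [mul_pos (sub_pos.2 h3) (sub_pos.2 h4), mul_pos (sub_pos.2 h3) (sub_pos.2 hβ),
    mul_pos (mul_pos (sub_pos.2 h3) (sub_pos.2 hβ)) (sub_pos.2 h4),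
    mul_pos (sub_pos.2 h3) (pow_pos (sub_pos.2 hβ) 2),
    mul_pos (sub_pos.2 h3) (pow_pos (sub_pos.2 h4) 2)]

/-- For `2 ≤ λ < λ*` there is a uniform bound on the number of vertices of connected graphs
whose smallest eigenvalue lies in `[-λ, -2)`. -/
theorem finitely_many_connected_graphs_in_window
    (βs lamStar : ℝ) (hβs : βs ^ 3 = βs + 1)
    (hstar : lamStar = Real.sqrt βs + (Real.sqrt βs)⁻¹)
    (lam : ℝ) (h2 : 2 ≤ lam) (hlt : lam < lamStar) :
    ∃ N : ℕ, ∀ (n : ℕ) (G : SimpleGraph (Fin n)), G.Connected →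
      -lam ≤ minEig (adjMat G) → minEig (adjMat G) < -2 → n ≤ N := by
  rcases h2.eq_or_lt with rfl | h2
  · exact ⟨0, fun n G _ h3 h4 => absurd h3 (not_le.2 h4)⟩
  obtain ⟨t, ht, ht6, rfl⟩ := exists_add_inv_eq hβs hstar h2 hlt
  have P : Params t (t + t⁻¹ - 2) (t / (t - 1) ^ 2) (t / (t - 1)) := ⟨ht, ht6, rfl, rfl, rfl⟩
  obtain ⟨K, hK5, hK⟩ := P.exists_isLarge
  obtain ⟨N, hN⟩ := exists_isRep_of_card_lt (2 * K)
  refine ⟨N, fun n G hG h3 h4 => ?_⟩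
  by_contra! hn
  have hform := form_nonneg_of_le_minEig G h3
  have hlam : t + t⁻¹ < 2.1 := by
    have := P.eps_lt
    norm_num at this ⊢
    linarith
  obtain ⟨W, φ, h⟩ := hN (Fin n) G (t + t⁻¹) hlam hG hform (by rwa [Fintype.card_fin])
  obtain ⟨n', T, ψ, h'⟩ := IsRep.exists_univ P hK5 hK hG hform _ (Nat.le_succ _) h rfl
  refine absurd (le_minEig_of_form_nonneg G fun z => ?_) (not_le.2 h4)
  rw [← h'.quad_eq fun x hx => absurd (Finset.mem_univ x) hx]
  exact Finset.sum_nonneg fun i _ => sq_nonneg _
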